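/- arXiv:1912.10415 — 2 statements merged into one kernel-verified Lean document; each statement's English description precedes it below -/
import Mathlib

section
/- Let p be a positive even integer, π = (π_n) a sequence of finite partitions of [0,1] with mesh tending to 0, and ω : [0,1] → ℝ continuous with ω(0) = 0, having finite p-th variation along π with [ω]_p^π(t) = c·t for all t ∈ [0,1], where c ≥ 0 is a constant. Let a, b ∈ ℝ and define Y(t) := exp( b·ω(t) + (a − (c/p!)·b^p)·t ). Then for every t ∈ (0,1], the compensated Riemann sums Σ_{[t_j,t_{j+1}]∈π_n} Σ_{k=1}^{p−1} (b^k/k!) Y(t_j) (ω(t_{j+1}∧t) − ω(t_j∧t))^k converge in ℝ as n → ∞, and Y(t) = 1 + ∫_0^t a·Y(r) dr + lim_{n→∞} Σ_{[t_j,t_{j+1}]∈π_n} Σ_{k=1}^{p−1} (b^k/k!) Y(t_j) (ω(t_{j+1}∧t) − ω(t_j∧t))^k; that is, Y is a strong solution of dY_t = a Y_t dt + b Y_t d^π ω_t with Y(0) = 1. -/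
open MeasureTheory Filter Set Topology

/-- A finite partition `a = t 0 < t 1 < ... < t N = b` of the interval `[a, b]`. -/
structure IntervalPartition (a b : ℝ) where
  N : ℕ
  hN : 0 < N
  t : ℕ → ℝ
  mono : ∀ i, i < N → t i < t (i + 1)
  first : t 0 = a
  last : t N = b

namespace S12

lemma part_mono (P : IntervalPartition 0 1) : ∀ i j, i ≤ j → j ≤ P.N → P.t i ≤ P.t j := by
  intro i j hij
  induction j, hij using Nat.le_induction with
  | base => intro _; exact le_rfl
  | succ k hk ih => intro h; exact (ih (by omega)).trans (P.mono k (by omega)).le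

lemma part_mem (P : IntervalPartition 0 1) (j : ℕ) (hj : j ≤ P.N) : P.t j ∈ Icc (0:ℝ) 1 := by
  constructor
  · have := part_mono P 0 j (by omega) hj
    rwa [P.first] at this
  · have := part_mono P j P.N hj le_rfl
    rwa [P.last] at this

/-- identification of the measure -/
lemma meas_eq (π : ℕ → IntervalPartition 0 1) (w : ℕ → ℕ → ℝ) (c : ℝ) (hc : 0 ≤ c)
    (μ : Measure ℝ) [IsFiniteMeasure μ]
    (hweak : ∀ g : ℝ → ℝ, Continuous g → (∃ M : ℝ, ∀ x, |g x| ≤ M) →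
      Tendsto (fun n => ∑ j ∈ Finset.range (π n).N, w n j * g ((π n).t j)) atTop
        (𝓝 (∫ x, g x ∂μ)))
    (hvar : ∀ t ∈ Icc (0 : ℝ) 1, μ (Icc 0 t) = ENNReal.ofReal (c * t)) :
    μ = ENNReal.ofReal c • volume.restrict (Icc (0:ℝ) 1) := by
  -- μ vanishes off [0,1]
  have hoff : μ (Icc (0:ℝ) 1)ᶜ = 0 := by
    let g : ℝ → ℝ := fun x => min 1 (max 0 (max (-x) (x - 1)))
    have hgc : Continuous g := by fun_prop
    have hg0 : ∀ x, 0 ≤ g x := fun x => le_min zero_le_one (le_max_left _ _)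
    have hg1 : ∀ x, |g x| ≤ 1 := fun x => by rw [abs_of_nonneg (hg0 x)]; exact min_le_left _ _
    have h := hweak g hgc ⟨1, hg1⟩
    have hz : ∀ n, ∑ j ∈ Finset.range (π n).N, w n j * g ((π n).t j) = 0 := by
      intro n
      apply Finset.sum_eq_zero
      intro j hj
      have hm := part_mem (π n) j (Finset.mem_range.1 hj).le
      have : g ((π n).t j) = 0 := by
        simp only [g]
        rw [max_eq_left (max_le (by linarith [hm.1]) (by linarith [hm.2]))]
        simp
      rw [this, mul_zero]
    simp_rw [hz] at h
    have hi : ∫ x, g x ∂μ = 0 := (tendsto_nhds_unique h tendsto_const_nhds)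
    have hint : Integrable g μ := by
      refine Integrable.of_bound hgc.aestronglyMeasurable 1 (Eventually.of_forall ?_)
      intro x; exact hg1 x
    have hae := (integral_eq_zero_iff_of_nonneg hg0 hint).1 hi
    refine measure_mono_null ?_ hae
    intro x hx
    simp only [mem_compl_iff, mem_Icc, not_and_or, not_le] at hx
    have : 0 < g x := by
      simp only [g]
      refine lt_min one_pos (lt_max_of_lt_right ?_)
      rcases hx with hx | hx
      · exact lt_max_of_lt_left (by linarith)
      · exact lt_max_of_lt_right (by linarith)
    simp only [mem_compl_iff, mem_ofPred_eq]
    exact this.ne'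
  have hμ : μ = μ.restrict (Icc 0 1) := by
    symm
    apply Measure.restrict_eq_self_of_ae_mem
    exact hoff
  have : IsFiniteMeasure (ENNReal.ofReal c • volume.restrict (Icc (0:ℝ) 1)) :=
    Measure.smul_finite _ ENNReal.ofReal_ne_top
  apply Measure.ext_of_Iic
  intro t
  rw [hμ, Measure.restrict_apply measurableSet_Iic, Measure.smul_apply,
    Measure.restrict_apply measurableSet_Iic]
  have hs : Iic t ∩ Icc (0:ℝ) 1 = Icc 0 (min t 1) := by
    ext x; simp only [mem_inter_iff, mem_Iic, mem_Icc, le_min_iff]; tauto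
  rw [hs, Real.volume_Icc, smul_eq_mul, ← ENNReal.ofReal_mul hc, sub_zero]
  by_cases ht : 0 ≤ min t 1
  · exact hvar _ ⟨ht, min_le_right _ _⟩
  · push Not at ht
    rw [Icc_eq_empty (by linarith), measure_empty, ENNReal.ofReal_of_nonpos]
    exact mul_nonpos_of_nonneg_of_nonpos hc ht.le

lemma cut (π : ℕ → IntervalPartition 0 1) (w : ℕ → ℕ → ℝ) (hw : ∀ n j, 0 ≤ w n j)
    (c : ℝ) (hc : 0 ≤ c)
    (μ : Measure ℝ) [IsFiniteMeasure μ]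
    (hweak : ∀ g : ℝ → ℝ, Continuous g → (∃ M : ℝ, ∀ x, |g x| ≤ M) →
      Tendsto (fun n => ∑ j ∈ Finset.range (π n).N, w n j * g ((π n).t j)) atTop
        (𝓝 (∫ x, g x ∂μ)))
    (hμ : μ = ENNReal.ofReal c • volume.restrict (Icc (0:ℝ) 1))
    (G : ℝ → ℝ) (hG : Continuous G) (M : ℝ) (hM : ∀ x, |G x| ≤ M)
    (t : ℝ) (ht : t ∈ Ioc (0:ℝ) 1) :
    Tendsto (fun n => ∑ j ∈ Finset.range (π n).N, w n j * (Iio t).indicator G ((π n).t j)) atTop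
      (𝓝 (c * ∫ x in (0:ℝ)..t, G x)) := by
  have hM0 : 0 ≤ M := (abs_nonneg _).trans (hM 0)
  have hval : c * ∫ x in (0:ℝ)..t, G x = ∫ x, (Iio t).indicator G x ∂μ := by
    rw [hμ, integral_smul_measure, integral_indicator measurableSet_Iio,
      Measure.restrict_restrict measurableSet_Iio, ENNReal.toReal_ofReal hc, smul_eq_mul,
      intervalIntegral.integral_of_le ht.1.le]
    congr 1
    rw [integral_Ioc_eq_integral_Ioo, ← integral_Ico_eq_integral_Ioo]
    congr 2
    ext x; simp only [mem_Ico, mem_inter_iff, mem_Iio, mem_Icc]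
    constructor
    · rintro ⟨h1, h2⟩; exact ⟨h2, h1, by linarith [ht.2]⟩
    · rintro ⟨h1, h2, h3⟩; exact ⟨h2, h1⟩
  rw [hval]
  let ψ : ℝ → ℝ → ℝ := fun δ x => max 0 (1 - |x - t| / δ)
  let χ : ℝ → ℝ → ℝ := fun δ x => min 1 (max 0 (1 - (x - t) / δ))
  have hψc : ∀ δ, Continuous (ψ δ) := fun δ => by fun_prop
  have hχc : ∀ δ, Continuous (χ δ) := fun δ => by fun_prop
  have hψ0 : ∀ δ x, 0 ≤ ψ δ x := fun δ x => le_max_left _ _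
  have hψ1 : ∀ δ, 0 < δ → ∀ x, |ψ δ x| ≤ 1 := fun δ hδ x => by
    rw [abs_of_nonneg (hψ0 δ x)]
    exact max_le zero_le_one (by linarith [div_nonneg (abs_nonneg (x - t)) hδ.le])
  have hχ1 : ∀ δ x, |χ δ x| ≤ 1 := fun δ x => by
    rw [abs_of_nonneg (le_min zero_le_one (le_max_left _ _))]; exact min_le_left _ _
  have hkey : ∀ δ, 0 < δ → ∀ x, |(Iio t).indicator G x - χ δ x * G x| ≤ M * ψ δ x := by
    intro δ hδ x
    by_cases hx : x < t
    · have : χ δ x = 1 := by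
        have h1 : (x - t) / δ ≤ 0 := div_nonpos_of_nonpos_of_nonneg (by linarith) hδ.le
        simp only [χ]
        exact min_eq_left (le_max_of_le_right (by linarith))
      rw [indicator_of_mem (show x ∈ Iio t from hx), this]
      simp only [one_mul, sub_self, abs_zero]
      exact mul_nonneg hM0 (hψ0 _ _)
    · push Not at hx
      have : χ δ x = ψ δ x := by
        have h1 : 0 ≤ (x - t) / δ := div_nonneg (by linarith) hδ.le
        simp only [χ, ψ]
        rw [abs_of_nonneg (by linarith : 0 ≤ x - t)]
        exact min_eq_right (max_le zero_le_one (by linarith))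
      rw [indicator_of_notMem (by simpa using hx), this, zero_sub, abs_neg, abs_mul,
        abs_of_nonneg (hψ0 _ _), mul_comm]
      exact mul_le_mul_of_nonneg_right (hM x) (hψ0 _ _)
  have hintψ : ∀ δ, 0 < δ → Integrable (ψ δ) μ := fun δ hδ =>
    Integrable.of_bound (hψc δ).aestronglyMeasurable 1 (Eventually.of_forall (hψ1 δ hδ))
  have hψint : ∀ δ, 0 < δ → ∫ x, ψ δ x ∂μ ≤ c * (2 * δ) := by
    intro δ hδ
    have h1 : ∫ x, ψ δ x ∂μ ≤ ∫ x, (Icc (t - δ) (t + δ)).indicator (fun _ => (1:ℝ)) x ∂μ := by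
      apply integral_mono (hintψ δ hδ)
      · exact (integrable_const (1:ℝ)).indicator measurableSet_Icc
      · intro x
        by_cases hx : x ∈ Icc (t - δ) (t + δ)
        · simp only [indicator_of_mem hx]
          exact (le_abs_self _).trans (hψ1 δ hδ x)
        · simp only [indicator_of_notMem hx]
          refine max_le le_rfl ?_
          have : δ < |x - t| := by
            by_contra h
            push Not at h
            rw [abs_le] at h
            exact hx ⟨by linarith, by linarith⟩
          have := (one_lt_div hδ).2 this
          linarith
    refine h1.trans ?_
    rw [integral_indicator_const _ measurableSet_Icc, smul_eq_mul, mul_one, Measure.real, hμ,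
      Measure.smul_apply, smul_eq_mul, ENNReal.toReal_mul, ENNReal.toReal_ofReal hc]
    apply mul_le_mul_of_nonneg_left _ hc
    apply ENNReal.toReal_le_of_le_ofReal (by linarith)
    refine (Measure.restrict_apply_le _ _).trans ?_
    rw [Real.volume_Icc]
    apply ENNReal.ofReal_le_ofReal; linarith
  have hχG : ∀ δ x, |χ δ x * G x| ≤ M := fun δ x => by
    rw [abs_mul]
    calc _ ≤ 1 * M := mul_le_mul (hχ1 δ x) (hM x) (abs_nonneg _) zero_le_one
      _ = M := one_mul M
  rw [Metric.tendsto_atTop']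
  intro ε hε
  obtain ⟨δ, hδ, hδε⟩ : ∃ δ > 0, M * (c * (2 * δ)) < ε / 4 := by
    refine ⟨ε / (8 * (M * c + 1)), by positivity, ?_⟩
    have hMc : 0 ≤ M * c := by positivity
    have : M * (c * (2 * (ε / (8 * (M * c + 1))))) = ε / 4 * (M * c / (M * c + 1)) := by
      field_simp; ring
    rw [this]
    have : M * c / (M * c + 1) < 1 := by rw [div_lt_one (by linarith)]; linarith
    nlinarith
  have hψI : M * ∫ x, ψ δ x ∂μ < ε / 4 :=
    (mul_le_mul_of_nonneg_left (hψint δ hδ) hM0).trans_lt hδε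
  have e1 := (Metric.tendsto_atTop'.1 (hweak (fun x => χ δ x * G x) ((hχc δ).mul hG)
    ⟨M, hχG δ⟩)) (ε / 4) (by linarith)
  have e2 : ∀ᶠ n in atTop, M * ∑ j ∈ Finset.range (π n).N, w n j * ψ δ ((π n).t j) < ε / 4 :=
    ((hweak (ψ δ) (hψc δ) ⟨1, hψ1 δ hδ⟩).const_mul M).eventually (gt_mem_nhds hψI)
  have e3 : |∫ x, (Iio t).indicator G x ∂μ - ∫ x, χ δ x * G x ∂μ| ≤ M * ∫ x, ψ δ x ∂μ := by
    rw [← integral_sub]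
    · rw [← integral_const_mul, ← Real.norm_eq_abs]
      refine norm_integral_le_of_norm_le ((hintψ δ hδ).const_mul M) ?_
      exact Eventually.of_forall (fun x => hkey δ hδ x)
    · exact (Integrable.of_bound hG.aestronglyMeasurable M
        (Eventually.of_forall hM)).indicator measurableSet_Iio
    · exact Integrable.of_bound ((hχc δ).mul hG).aestronglyMeasurable M
        (Eventually.of_forall (hχG δ))
  obtain ⟨n1, e1⟩ := e1
  obtain ⟨n2, e2⟩ := eventually_atTop.1 e2
  refine ⟨max n1 n2, fun n hn => ?_⟩
  have f1 := e1 n (lt_of_le_of_lt (le_max_left _ _) hn)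
  have f2 := e2 n ((le_max_right _ _).trans hn.le)
  have f3 : |∑ j ∈ Finset.range (π n).N, w n j * (Iio t).indicator G ((π n).t j) -
      ∑ j ∈ Finset.range (π n).N, w n j * (χ δ ((π n).t j) * G ((π n).t j))| ≤
      M * ∑ j ∈ Finset.range (π n).N, w n j * ψ δ ((π n).t j) := by
    rw [← Finset.sum_sub_distrib, Finset.mul_sum]
    refine (Finset.abs_sum_le_sum_abs _ _).trans (Finset.sum_le_sum fun j _ => ?_)
    rw [← mul_sub, abs_mul, abs_of_nonneg (hw n j), mul_left_comm]
    exact mul_le_mul_of_nonneg_left (hkey δ hδ _) (hw n j)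
  rw [Real.dist_eq] at f1 ⊢
  rw [abs_le] at f3 e3
  rw [abs_lt] at f1 ⊢
  constructor <;> linarith [f3.1, f3.2, e3.1, e3.2, f1.1, f1.2]

lemma osc (π : ℕ → IntervalPartition 0 1)
    (hmesh : ∀ ε > 0, ∃ n₀ : ℕ, ∀ n ≥ n₀, ∀ i < (π n).N, (π n).t (i + 1) - (π n).t i < ε)
    (W : ℝ → ℝ) (hW : Continuous W) (ε : ℝ) (hε : 0 < ε) :
    ∀ᶠ n in atTop, ∀ j < (π n).N, ∀ u ∈ Icc ((π n).t j) ((π n).t (j+1)),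
      ∀ v ∈ Icc ((π n).t j) ((π n).t (j+1)), |W u - W v| ≤ ε := by
  have h := isCompact_Icc.uniformContinuousOn_of_continuous (hW.continuousOn (s := Icc (0:ℝ) 1))
  rw [Metric.uniformContinuousOn_iff] at h
  obtain ⟨δ, hδ, h⟩ := h ε hε
  obtain ⟨n0, h0⟩ := hmesh δ hδ
  filter_upwards [eventually_ge_atTop n0] with n hn j hj u hu v hv
  have hm := h0 n hn j hj
  have m1 := part_mem (π n) j hj.le
  have m2 := part_mem (π n) (j+1) hj
  refine (h u ⟨m1.1.trans hu.1, hu.2.trans m2.2⟩ v ⟨m1.1.trans hv.1, hv.2.trans m2.2⟩ ?_).le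
  rw [Real.dist_eq, abs_lt]
  constructor <;> linarith [hu.1, hu.2, hv.1, hv.2]

/-- only one interval of the partition contains `t` in its interior -/
lemma sum_straddle (P : IntervalPartition 0 1) (t : ℝ) (f : ℕ → ℝ) (C : ℝ) (hC : 0 ≤ C)
    (hf : ∀ j < P.N, |f j| ≤ C)
    (hz : ∀ j < P.N, f j ≠ 0 → P.t j < t ∧ t < P.t (j+1)) :
    |∑ j ∈ Finset.range P.N, f j| ≤ C := by
  let e : ℕ → ℝ := fun j => if P.t j < t then 1 else 0
  have h1 : ∀ j ∈ Finset.range P.N, |f j| ≤ C * (e j - e (j+1)) := by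
    intro j hj
    have hj := Finset.mem_range.1 hj
    by_cases h0 : f j = 0
    · rw [h0, abs_zero]
      apply mul_nonneg hC
      have := P.mono j hj
      simp only [e]
      split_ifs <;> first | linarith | norm_num
    · obtain ⟨ha, hb⟩ := hz j hj h0
      simp only [e, if_pos ha, if_neg (not_lt.2 hb.le)]
      simpa using hf j hj
  calc _ ≤ ∑ j ∈ Finset.range P.N, |f j| := Finset.abs_sum_le_sum_abs _ _
    _ ≤ ∑ j ∈ Finset.range P.N, C * (e j - e (j+1)) := Finset.sum_le_sum h1
    _ = C * (e 0 - e P.N) := by rw [← Finset.mul_sum, Finset.sum_range_sub']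
    _ ≤ C * 1 := by
      apply mul_le_mul_of_nonneg_left _ hC
      simp only [e]; split_ifs <;> norm_num
    _ = C := mul_one C

lemma min_mem (P : IntervalPartition 0 1) (t : ℝ) (j : ℕ) (hj : j < P.N) (h : P.t j ≤ t) :
    min (P.t (j+1)) t ∈ Icc (P.t j) (P.t (j+1)) :=
  ⟨le_min (P.mono j hj).le h, min_le_left _ _⟩

/-- increments of the truncated sequence are controlled by those of the partition -/
lemma trunc_osc (P : IntervalPartition 0 1) (t : ℝ) (W : ℝ → ℝ) (ε : ℝ) (hε : 0 ≤ ε) (j : ℕ)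
    (hj : j < P.N)
    (h : ∀ u ∈ Icc (P.t j) (P.t (j+1)), ∀ v ∈ Icc (P.t j) (P.t (j+1)), |W u - W v| ≤ ε)
    (u v : ℝ) (hu : u ∈ Icc (min (P.t j) t) (min (P.t (j+1)) t))
    (hv : v ∈ Icc (min (P.t j) t) (min (P.t (j+1)) t)) : |W u - W v| ≤ ε := by
  by_cases ht : P.t j ≤ t
  · rw [min_eq_left ht] at hu hv
    exact h u ⟨hu.1, hu.2.trans (min_le_left _ _)⟩ v ⟨hv.1, hv.2.trans (min_le_left _ _)⟩
  · push Not at ht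
    have := P.mono j hj
    rw [min_eq_right ht.le, min_eq_right (by linarith)] at hu hv
    have : u = v := by linarith [hu.1, hu.2, hv.1, hv.2]
    rw [this, sub_self, abs_zero]; exact hε

lemma main_term (p : ℕ) (hp : 0 < p) (π : ℕ → IntervalPartition 0 1)
    (hmesh : ∀ ε > 0, ∃ n₀ : ℕ, ∀ n ≥ n₀, ∀ i < (π n).N, (π n).t (i + 1) - (π n).t i < ε)
    (W : ℝ → ℝ) (hW : Continuous W) (c : ℝ) (hc : 0 ≤ c)
    (μ : Measure ℝ) [IsFiniteMeasure μ]
    (hweak : ∀ g : ℝ → ℝ, Continuous g → (∃ M : ℝ, ∀ x, |g x| ≤ M) →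
      Tendsto (fun n => ∑ j ∈ Finset.range (π n).N,
          |W ((π n).t (j + 1)) - W ((π n).t j)| ^ p * g ((π n).t j)) atTop
        (𝓝 (∫ x, g x ∂μ)))
    (hvar : ∀ t ∈ Icc (0 : ℝ) 1, μ (Icc 0 t) = ENNReal.ofReal (c * t))
    (Y : ℝ → ℝ) (hY : Continuous Y) (t : ℝ) (ht : t ∈ Ioc (0:ℝ) 1) :
    Tendsto (fun n => ∑ j ∈ Finset.range (π n).N,
      Y (min ((π n).t j) t) * |W (min ((π n).t (j + 1)) t) - W (min ((π n).t j) t)| ^ p) atTop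
      (𝓝 (c * ∫ x in (0:ℝ)..t, Y x)) := by
  let G : ℝ → ℝ := fun x => Y (max 0 (min 1 x))
  have hG : Continuous G := by fun_prop
  have hGY : ∀ x ∈ Icc (0:ℝ) 1, G x = Y x := fun x hx => by
    simp only [G]; rw [min_eq_right hx.2, max_eq_right hx.1]
  obtain ⟨M, hM⟩ := isCompact_Icc.exists_bound_of_continuousOn (hY.continuousOn (s := Icc (0:ℝ) 1))
  have hGM : ∀ x, |G x| ≤ M := fun x =>
    hM _ ⟨le_max_left _ _, max_le zero_le_one (min_le_left _ _)⟩
  have hM0 : 0 ≤ M := (abs_nonneg _).trans (hGM 0)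
  have hμ := meas_eq π (fun n j => |W ((π n).t (j + 1)) - W ((π n).t j)| ^ p) c hc μ hweak hvar
  have hcut := cut π (fun n j => |W ((π n).t (j + 1)) - W ((π n).t j)| ^ p)
    (fun n j => by positivity) c hc μ hweak hμ G hG M hGM t ht
  have hint : ∫ x in (0:ℝ)..t, G x = ∫ x in (0:ℝ)..t, Y x := by
    apply intervalIntegral.integral_congr
    intro x hx
    rw [uIcc_of_le ht.1.le] at hx
    exact hGY x ⟨hx.1, hx.2.trans ht.2⟩
  rw [hint] at hcut
  have hd : Tendsto (fun n => ∑ j ∈ Finset.range (π n).N,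
      (Y (min ((π n).t j) t) * |W (min ((π n).t (j + 1)) t) - W (min ((π n).t j) t)| ^ p -
      |W ((π n).t (j + 1)) - W ((π n).t j)| ^ p * (Iio t).indicator G ((π n).t j))) atTop
      (𝓝 0) := by
    rw [Metric.tendsto_nhds]
    intro ε hε
    obtain ⟨η, hη0, hη1, hη⟩ : ∃ η : ℝ, 0 < η ∧ η ≤ 1 ∧ 2 * M * η < ε := by
      refine ⟨min 1 (ε / (2 * M + 1)), lt_min one_pos (by positivity), min_le_left _ _, ?_⟩
      calc 2 * M * min 1 (ε / (2 * M + 1)) ≤ 2 * M * (ε / (2 * M + 1)) := by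
            gcongr; exact min_le_right _ _
        _ < ε := by
          rw [← mul_div_assoc, div_lt_iff₀ (by positivity)]; nlinarith
    filter_upwards [osc π hmesh W hW η hη0] with n hn
    rw [Real.dist_eq, sub_zero]
    refine lt_of_le_of_lt (sum_straddle (π n) t _ (2 * M * η) (by positivity) ?_ ?_) hη
    · intro j hj
      have hm1 := (π n).mono j hj
      have hpw : ∀ x : ℝ, |x| ≤ η → |x| ^ p ≤ η := fun x hx =>
        (pow_le_of_le_one (abs_nonneg _) (hx.trans hη1) hp.ne').trans hx
      have b1 : |W (min ((π n).t (j + 1)) t) - W (min ((π n).t j) t)| ^ p ≤ η := by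
        apply hpw
        have hmm : min ((π n).t j) t ≤ min ((π n).t (j+1)) t := min_le_min_right _ hm1.le
        exact trunc_osc (π n) t W η hη0.le j hj (hn j hj) _ _ ⟨hmm, le_rfl⟩ ⟨le_rfl, hmm⟩
      have b2 : |W ((π n).t (j + 1)) - W ((π n).t j)| ^ p ≤ η :=
        hpw _ (hn j hj _ ⟨hm1.le, le_rfl⟩ _ ⟨le_rfl, hm1.le⟩)
      have b3 : |Y (min ((π n).t j) t)| ≤ M :=
        hM _ ⟨le_min (part_mem _ j hj.le).1 ht.1.le, (min_le_right _ _).trans ht.2⟩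
      have b4 : |(Iio t).indicator G ((π n).t j)| ≤ M := by
        by_cases h : (π n).t j ∈ Iio t
        · rw [indicator_of_mem h]; exact hGM _
        · rw [indicator_of_notMem h, abs_zero]; exact hM0
      refine (abs_sub _ _).trans ?_
      rw [abs_mul, abs_mul, abs_pow, abs_pow, abs_abs, abs_abs]
      have c1 := mul_le_mul b3 b1 (by positivity) hM0
      have c2 := mul_le_mul b2 b4 (by positivity) hη0.le
      linarith
    · intro j hj hne
      have hm1 := (π n).mono j hj
      by_contra hcon
      apply hne
      rw [not_and_or, not_lt, not_lt] at hcon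
      by_cases h : t ≤ (π n).t j
      · rw [min_eq_right h, min_eq_right (h.trans hm1.le), indicator_of_notMem (by simpa using h)]
        simp [hp.ne']
      · push Not at h
        have h2 : (π n).t (j+1) ≤ t := hcon.resolve_left (not_le.2 h)
        rw [min_eq_left h.le, min_eq_left h2, indicator_of_mem (show _ ∈ Iio t from h),
          hGY _ (part_mem _ j hj.le)]
        ring
  have := hd.add hcut
  rw [zero_add] at this
  refine this.congr fun n => ?_
  rw [Finset.sum_sub_distrib]; ring

lemma riemann_term (π : ℕ → IntervalPartition 0 1)
    (hmesh : ∀ ε > 0, ∃ n₀ : ℕ, ∀ n ≥ n₀, ∀ i < (π n).N, (π n).t (i + 1) - (π n).t i < ε)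
    (W : ℝ → ℝ) (hW : Continuous W) (d : ℝ) (t : ℝ) (ht : t ∈ Ioc (0:ℝ) 1) :
    Tendsto (fun n => ∑ j ∈ Finset.range (π n).N,
      W (min ((π n).t (j+1)) t) *
        (Real.exp (d * min ((π n).t (j+1)) t) - Real.exp (d * min ((π n).t j) t))) atTop
      (𝓝 (d * ∫ x in (0:ℝ)..t, W x * Real.exp (d * x))) := by
  let K : ℝ := |d| * Real.exp |d|
  have hK : 0 ≤ K := by positivity
  rw [Metric.tendsto_nhds]
  intro ε hε
  have hη0 : 0 < ε / (K + 1) := by positivity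
  set η := ε / (K + 1) with hηdef
  have hη : K * η < ε := by
    rw [hηdef, ← mul_div_assoc, div_lt_iff₀ (by positivity)]; nlinarith
  filter_upwards [osc π hmesh W hW η hη0] with n hn
  have hcont : Continuous fun x => W x * (d * Real.exp (d * x)) := by fun_prop
  have hsplit : d * ∫ x in (0:ℝ)..t, W x * Real.exp (d * x) = ∑ j ∈ Finset.range (π n).N,
      ∫ x in (min ((π n).t j) t)..(min ((π n).t (j+1)) t), W x * (d * Real.exp (d * x)) := by
    rw [intervalIntegral.sum_integral_adjacent_intervals
      (a := fun j => min ((π n).t j) t) (fun k _ => hcont.intervalIntegrable _ _)]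
    simp only [(π n).first, (π n).last, min_eq_left ht.1.le, min_eq_right ht.2]
    rw [← intervalIntegral.integral_const_mul]
    congr 1; ext x; ring
  rw [Real.dist_eq, hsplit, ← Finset.sum_sub_distrib]
  refine lt_of_le_of_lt ?_ hη
  calc _ ≤ ∑ j ∈ Finset.range (π n).N, K * η * (min ((π n).t (j+1)) t - min ((π n).t j) t) := by
        refine (Finset.abs_sum_le_sum_abs _ _).trans (Finset.sum_le_sum fun j hj => ?_)
        have hj := Finset.mem_range.1 hj
        have hm1 := (π n).mono j hj
        have hmm : min ((π n).t j) t ≤ min ((π n).t (j+1)) t := min_le_min_right _ hm1.le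
        have h0 : 0 ≤ min ((π n).t j) t := le_min (part_mem _ j hj.le).1 ht.1.le
        have h1 : min ((π n).t (j+1)) t ≤ 1 := (min_le_right _ _).trans ht.2
        have htr := trunc_osc (π n) t W η hη0.le j hj (hn j hj)
        generalize min ((π n).t j) t = s at *
        generalize min ((π n).t (j+1)) t = s' at *
        have hft : ∫ x in s..s', d * Real.exp (d * x) = Real.exp (d * s') - Real.exp (d * s) := by
          apply intervalIntegral.integral_eq_sub_of_hasDerivAt
          · intro x _
            have := ((hasDerivAt_id x).const_mul d).exp
            simpa [mul_comm] using this
          · exact (by fun_prop : Continuous fun x => d * Real.exp (d * x)).intervalIntegrable _ _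
        rw [← hft, ← intervalIntegral.integral_const_mul, ← intervalIntegral.integral_sub]
        · have := intervalIntegral.norm_integral_le_of_norm_le_const (a := s) (b := s')
            (C := K * η) (f := fun x => W s' * (d * Real.exp (d * x)) -
              W x * (d * Real.exp (d * x))) ?_
          · rwa [Real.norm_eq_abs, abs_of_nonneg (by linarith : 0 ≤ s' - s)] at this
          · intro x hx
            rw [uIoc_of_le hmm] at hx
            rw [← sub_mul, norm_mul, norm_mul, Real.norm_eq_abs, Real.norm_eq_abs,
              Real.norm_eq_abs, Real.abs_exp, mul_comm]
            refine mul_le_mul ?_ (htr _ _ ⟨hmm, le_rfl⟩ ⟨hx.1.le, hx.2⟩) (abs_nonneg _) hK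
            refine mul_le_mul_of_nonneg_left (Real.exp_le_exp.2 ?_) (abs_nonneg _)
            have hx0 : 0 ≤ x := by linarith [hx.1]
            have hx1 : x ≤ 1 := by linarith [hx.2]
            calc d * x ≤ |d| * x := mul_le_mul_of_nonneg_right (le_abs_self d) hx0
              _ ≤ |d| * 1 := mul_le_mul_of_nonneg_left hx1 (abs_nonneg _)
              _ = |d| := mul_one _
        · exact (by fun_prop : Continuous fun x =>
            W s' * (d * Real.exp (d * x))).intervalIntegrable _ _
        · exact hcont.intervalIntegrable _ _
    _ = K * η * t := by
        rw [← Finset.mul_sum, Finset.sum_range_sub (fun j => min ((π n).t j) t)]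
        simp only [(π n).first, (π n).last, min_eq_left ht.1.le, min_eq_right ht.2, sub_zero]
    _ ≤ K * η * 1 := mul_le_mul_of_nonneg_left ht.2 (by positivity)
    _ = K * η := mul_one _

lemma taylor_term (p : ℕ) (π : ℕ → IntervalPartition 0 1)
    (hmesh : ∀ ε > 0, ∃ n₀ : ℕ, ∀ n ≥ n₀, ∀ i < (π n).N, (π n).t (i + 1) - (π n).t i < ε)
    (W : ℝ → ℝ) (hW : Continuous W) (b : ℝ) (Y : ℝ → ℝ) (hY0 : ∀ x, 0 ≤ Y x) (t L : ℝ)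
    (hT : Tendsto (fun n => ∑ j ∈ Finset.range (π n).N,
      Y (min ((π n).t j) t) * |W (min ((π n).t (j + 1)) t) - W (min ((π n).t j) t)| ^ p) atTop
      (𝓝 L)) :
    Tendsto (fun n => ∑ j ∈ Finset.range (π n).N,
      Y (min ((π n).t j) t) *
       (Real.exp (b * (W (min ((π n).t (j + 1)) t) - W (min ((π n).t j) t))) -
        ∑ m ∈ Finset.range (p+1),
          (b * (W (min ((π n).t (j + 1)) t) - W (min ((π n).t j) t))) ^ m / (m.factorial : ℝ)))
      atTop (𝓝 0) := by
  let C : ℝ := ((p+1).succ : ℝ) / (((p+1).factorial : ℝ) * ((p+1 : ℕ) : ℝ))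
  have hC : 0 ≤ C := by positivity
  let D : ℝ := C * |b| ^ (p+1)
  have hD : 0 ≤ D := by positivity
  rw [Metric.tendsto_nhds]
  intro ε hε
  have hL : 0 ≤ L := ge_of_tendsto' hT fun n =>
    Finset.sum_nonneg fun j _ => mul_nonneg (hY0 _) (by positivity)
  have e1 : ∀ᶠ n in atTop, ∑ j ∈ Finset.range (π n).N,
      Y (min ((π n).t j) t) * |W (min ((π n).t (j + 1)) t) - W (min ((π n).t j) t)| ^ p < L + 1 :=
    hT.eventually (gt_mem_nhds (by linarith))
  obtain ⟨η, hη0, hη1, hη⟩ : ∃ η : ℝ, 0 < η ∧ |b| * η ≤ 1 ∧ D * η * (L + 1) < ε := by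
    refine ⟨min (1 / (|b| + 1)) (ε / (D * (L + 1) + 1)), lt_min (by positivity) (by positivity),
      ?_, ?_⟩
    · calc _ ≤ |b| * (1 / (|b| + 1)) := by gcongr; exact min_le_left _ _
        _ ≤ 1 := by
          rw [← mul_div_assoc, div_le_one (by positivity)]; linarith
    · calc _ ≤ D * (ε / (D * (L + 1) + 1)) * (L + 1) := by gcongr; exact min_le_right _ _
        _ = (D * (L + 1) * ε) / (D * (L + 1) + 1) := by ring
        _ < ε := by
          rw [div_lt_iff₀ (by positivity)]; nlinarith
  filter_upwards [osc π hmesh W hW η hη0, e1] with n hn he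
  rw [Real.dist_eq, sub_zero]
  refine lt_of_le_of_lt ?_ hη
  refine le_trans ?_ (mul_le_mul_of_nonneg_left he.le (by positivity))
  rw [Finset.mul_sum]
  refine (Finset.abs_sum_le_sum_abs _ _).trans (Finset.sum_le_sum fun j hj => ?_)
  have hj := Finset.mem_range.1 hj
  have hmm : min ((π n).t j) t ≤ min ((π n).t (j+1)) t := min_le_min_right _ ((π n).mono j hj).le
  have hx := trunc_osc (π n) t W η hη0.le j hj (hn j hj) _ _ ⟨hmm, le_rfl⟩ ⟨le_rfl, hmm⟩
  generalize W (min ((π n).t (j + 1)) t) - W (min ((π n).t j) t) = x at *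
  rw [abs_mul, abs_of_nonneg (hY0 _), mul_left_comm]
  refine mul_le_mul_of_nonneg_left ?_ (hY0 _)
  have hbx : |b * x| ≤ 1 := by
    rw [abs_mul]; exact (mul_le_mul_of_nonneg_left hx (abs_nonneg _)).trans hη1
  refine (Real.exp_bound hbx (Nat.succ_pos p)).trans ?_
  calc |b * x| ^ (p+1) * C = D * |x| * |x| ^ p := by
        rw [abs_mul, mul_pow]; simp only [D]; ring
    _ ≤ D * η * |x| ^ p := by gcongr

lemma main (p : ℕ) (hp : 0 < p) (hpeven : Even p) (π : ℕ → IntervalPartition 0 1)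
    (hmesh : ∀ ε > 0, ∃ n₀ : ℕ, ∀ n ≥ n₀, ∀ i < (π n).N, (π n).t (i + 1) - (π n).t i < ε)
    (W : ℝ → ℝ) (hW : Continuous W) (hW0 : W 0 = 0) (c : ℝ) (hc : 0 ≤ c)
    (μ : Measure ℝ) [IsFiniteMeasure μ]
    (hweak : ∀ g : ℝ → ℝ, Continuous g → (∃ M : ℝ, ∀ x, |g x| ≤ M) →
      Tendsto (fun n => ∑ j ∈ Finset.range (π n).N,
          |W ((π n).t (j + 1)) - W ((π n).t j)| ^ p * g ((π n).t j)) atTop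
        (𝓝 (∫ x, g x ∂μ)))
    (hvar : ∀ t ∈ Icc (0 : ℝ) 1, μ (Icc 0 t) = ENNReal.ofReal (c * t))
    (a b : ℝ)
    (Y : ℝ → ℝ)
    (hY : ∀ t : ℝ, Y t = Real.exp (b * W t + (a - c / (p.factorial : ℝ) * b ^ p) * t))
    (t : ℝ) (ht : t ∈ Ioc (0 : ℝ) 1) :
    Tendsto (fun n => ∑ j ∈ Finset.range (π n).N, ∑ k ∈ Finset.Icc 1 (p - 1),
          (b ^ k / (k.factorial : ℝ)) * Y ((π n).t j) *
            (W (min ((π n).t (j + 1)) t) - W (min ((π n).t j) t)) ^ k) atTop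
      (𝓝 (Y t - 1 - ∫ r in (0 : ℝ)..t, a * Y r)) := by
  set d := a - c / (p.factorial : ℝ) * b ^ p with hd
  have hYc : Continuous Y := by
    rw [funext hY]; fun_prop
  have hY0 : ∀ x, 0 ≤ Y x := fun x => by rw [hY]; positivity
  have hT := main_term p hp π hmesh W hW c hc μ hweak hvar Y hYc t ht
  have hE := taylor_term p π hmesh W hW b Y hY0 t _ hT
  have hR := riemann_term π hmesh (fun x => Real.exp (b * W x)) (by fun_prop) d t ht
  have hYmul : ∀ x, Real.exp (b * W x) * Real.exp (d * x) = Y x := fun x => by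
    rw [hY, Real.exp_add]
  simp only [hYmul] at hR
  have hall := (((tendsto_const_nhds (x := Y t - 1)).sub hR).sub
    (hT.const_mul (b ^ p / (p.factorial : ℝ)))).sub hE
  have hlim : Y t - 1 - d * (∫ x in (0:ℝ)..t, Y x) -
      b ^ p / (p.factorial : ℝ) * (c * ∫ x in (0:ℝ)..t, Y x) - 0 =
      Y t - 1 - ∫ r in (0 : ℝ)..t, a * Y r := by
    rw [intervalIntegral.integral_const_mul, hd]; ring
  rw [hlim] at hall
  refine hall.congr fun n => ?_
  have htel : Y t - 1 = ∑ j ∈ Finset.range (π n).N,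
      (Y (min ((π n).t (j+1)) t) - Y (min ((π n).t j) t)) := by
    rw [Finset.sum_range_sub (fun j => Y (min ((π n).t j) t))]
    simp only [(π n).first, (π n).last, min_eq_left ht.1.le, min_eq_right ht.2]
    rw [hY 0, hW0]; simp
  rw [htel, Finset.mul_sum, ← Finset.sum_sub_distrib, ← Finset.sum_sub_distrib,
    ← Finset.sum_sub_distrib]
  refine Finset.sum_congr rfl fun j hj => ?_
  have hj := Finset.mem_range.1 hj
  have hrepl : ∑ k ∈ Finset.Icc 1 (p - 1), (b ^ k / (k.factorial : ℝ)) * Y ((π n).t j) *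
            (W (min ((π n).t (j + 1)) t) - W (min ((π n).t j) t)) ^ k =
      Y (min ((π n).t j) t) * ∑ k ∈ Finset.Icc 1 (p - 1),
        (b * (W (min ((π n).t (j + 1)) t) - W (min ((π n).t j) t))) ^ k / (k.factorial : ℝ) := by
    rw [Finset.mul_sum]
    refine Finset.sum_congr rfl fun k hk => ?_
    have hk := (Finset.mem_Icc.1 hk).1
    by_cases h : (π n).t j ≤ t
    · rw [min_eq_left h, mul_pow]; ring
    · push Not at h
      have hm := (π n).mono j hj
      rw [min_eq_right h.le, min_eq_right (by linarith)]
      simp [show k ≠ 0 by omega]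
  rw [hrepl]
  have hsum : ∀ y : ℝ, ∑ m ∈ Finset.range (p+1), y ^ m / (m.factorial : ℝ) =
      1 + ∑ k ∈ Finset.Icc 1 (p-1), y ^ k / (k.factorial : ℝ) + y ^ p / (p.factorial : ℝ) := by
    intro y
    rw [Finset.sum_range_succ, Finset.range_eq_Ico, Finset.sum_eq_sum_Ico_succ_bot hp]
    have : Finset.Ico (0+1) p = Finset.Icc 1 (p-1) := by
      ext k; simp only [Finset.mem_Ico, Finset.mem_Icc]; omega
    rw [this]; simp
  rw [hsum, hpeven.pow_abs, mul_pow]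
  generalize hs : min ((π n).t j) t = s
  generalize hs' : min ((π n).t (j+1)) t = s'
  have hexp : Y s * Real.exp (b * (W s' - W s)) = Real.exp (b * W s') * Real.exp (d * s) := by
    rw [hY, ← Real.exp_add, ← Real.exp_add]; congr 1; ring
  have h2 := hYmul s'
  simp only [mul_sub (Real.exp (b * W s')), h2, ← hexp]
  ring

end S12

/-- the generalized geometric (fractional) Brownian motion
`Y(t) = exp(b·ω(t) + (a − (c/p!)·b^p)·t)` is a strong solution of
`dY = aY dt + bY d^π ω`, `Y(0) = 1`, for a path `ω` of finite `p`-th variation along `π`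
with `[ω]_p^π(t) = c·t`. -/
theorem statement12
    (p : ℕ) (hp : 0 < p) (hpeven : Even p)
    (π : ℕ → IntervalPartition 0 1)
    (hmesh : ∀ ε > 0, ∃ n₀ : ℕ, ∀ n ≥ n₀, ∀ i < (π n).N, (π n).t (i + 1) - (π n).t i < ε)
    (ω : ℝ → ℝ) (hω : ContinuousOn ω (Icc 0 1)) (hω0 : ω 0 = 0)
    (c : ℝ) (hc : 0 ≤ c)
    -- `ω` has finite `p`-th variation along `π` with limit measure `μ`, `[ω]_p^π(t) = c·t`:
    (μ : Measure ℝ) [IsFiniteMeasure μ] (hμna : ∀ x : ℝ, μ {x} = 0)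
    (hweak : ∀ g : ℝ → ℝ, Continuous g → (∃ M : ℝ, ∀ x, |g x| ≤ M) →
      Tendsto (fun n => ∑ j ∈ Finset.range (π n).N,
          |ω ((π n).t (j + 1)) - ω ((π n).t j)| ^ p * g ((π n).t j)) atTop
        (𝓝 (∫ x, g x ∂μ)))
    (hvar : ∀ t ∈ Icc (0 : ℝ) 1, μ (Icc 0 t) = ENNReal.ofReal (c * t))
    (a b : ℝ)
    (Y : ℝ → ℝ)
    (hY : ∀ t : ℝ, Y t = Real.exp (b * ω t + (a - c / (p.factorial : ℝ) * b ^ p) * t)) :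
    ∀ t ∈ Ioc (0 : ℝ) 1, ∃ I : ℝ,
      Tendsto (fun n => ∑ j ∈ Finset.range (π n).N, ∑ k ∈ Finset.Icc 1 (p - 1),
          (b ^ k / (k.factorial : ℝ)) * Y ((π n).t j) *
            (ω (min ((π n).t (j + 1)) t) - ω (min ((π n).t j) t)) ^ k) atTop (𝓝 I) ∧
      Y t = 1 + (∫ r in (0 : ℝ)..t, a * Y r) + I := by
  have hproj : ∀ x : ℝ, max 0 (min 1 x) ∈ Icc (0:ℝ) 1 := fun x =>
    ⟨le_max_left _ _, max_le zero_le_one (min_le_left _ _)⟩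
  let W : ℝ → ℝ := fun x => ω (max 0 (min 1 x))
  have hW : Continuous W := hω.comp_continuous (by fun_prop) hproj
  have hWω : ∀ x ∈ Icc (0:ℝ) 1, W x = ω x := fun x hx => by
    simp only [W]; rw [min_eq_right hx.2, max_eq_right hx.1]
  let Z : ℝ → ℝ := fun t => Real.exp (b * W t + (a - c / (p.factorial : ℝ) * b ^ p) * t)
  have hZY : ∀ x ∈ Icc (0:ℝ) 1, Z x = Y x := fun x hx => by
    simp only [Z]; rw [hWω x hx, hY]
  intro t ht
  have hw' : ∀ g : ℝ → ℝ, Continuous g → (∃ M : ℝ, ∀ x, |g x| ≤ M) →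
      Tendsto (fun n => ∑ j ∈ Finset.range (π n).N,
          |W ((π n).t (j + 1)) - W ((π n).t j)| ^ p * g ((π n).t j)) atTop
        (𝓝 (∫ x, g x ∂μ)) := by
    intro g hg hM
    refine (hweak g hg hM).congr fun n => Finset.sum_congr rfl fun j hj => ?_
    have hj := Finset.mem_range.1 hj
    rw [hWω _ (S12.part_mem _ j hj.le), hWω _ (S12.part_mem _ (j+1) hj)]
  have h := S12.main p hp hpeven π hmesh W hW
    (by rw [hWω 0 ⟨le_rfl, zero_le_one⟩, hω0]) c hc μ hw' hvar a b Z (fun _ => rfl) t ht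
  refine ⟨_, h.congr fun n => Finset.sum_congr rfl fun j hj => Finset.sum_congr rfl
    fun k _ => ?_, ?_⟩
  · have hj := Finset.mem_range.1 hj
    have hm : ∀ i ≤ (π n).N, min ((π n).t i) t ∈ Icc (0:ℝ) 1 := fun i hi =>
      ⟨le_min (S12.part_mem _ i hi).1 ht.1.le, (min_le_right _ _).trans ht.2⟩
    rw [hZY _ (S12.part_mem _ j hj.le), hWω _ (hm j hj.le), hWω _ (hm (j+1) hj)]
  · have hint : ∫ r in (0:ℝ)..t, a * Z r = ∫ r in (0:ℝ)..t, a * Y r := by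
      apply intervalIntegral.integral_congr
      intro x hx
      rw [uIcc_of_le ht.1.le] at hx
      simp only [hZY x ⟨hx.1, hx.2.trans ht.2⟩]
    rw [hint, hZY t ⟨ht.1.le, ht.2⟩]; ring
end

section
/- Let V be a real Hilbert space, p a positive even integer, π = (π_n) a sequence of finite partitions of [0,1] with mesh tending to 0, and ω : [0,1] → ℝ continuous with ω(0) = 0, having finite p-th variation along π with [ω]_p^π(t) = c·t for all t ∈ [0,1], where c ≥ 0. Let S : [0,∞) → L(V) be a strongly continuous semigroup of bounded linear operators (S(0) = Id, S(t+s) = S(t)S(s), t ↦ S(t)x continuous for each x ∈ V). Let b ∈ ℝ \ {0} and let x₀, y₀ ∈ V be such that the map t ↦ S(t)x₀ is continuously differentiable on [0,1] with derivative S(t)y₀ (i.e. x₀ belongs to the domain of the generator A of S and y₀ = A x₀). Set c′ := (c/p!)·b^p and define Y(t) := exp( b·ω(t) − c′·t ) S(t) x₀. Then for every t ∈ (0,1], the compensated Riemann sums Σ_{[t_j,t_{j+1}]∈π_n} Σ_{k=1}^{p−1} (b^k/k!) Y(t_j) (ω(t_{j+1}∧t) − ω(t_j∧t))^k converge in V as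 n → ∞, and Y(t) = x₀ + ∫_0^t exp( b·ω(r) − c′·r ) S(r) y₀ dr + lim_{n→∞} Σ_{[t_j,t_{j+1}]∈π_n} Σ_{k=1}^{p−1} (b^k/k!) Y(t_j) (ω(t_{j+1}∧t) − ω(t_j∧t))^k; that is, Y is a strong solution of dY_t = A Y_t dt + b Y_t d^π ω_t with Y(0) = x₀, where A Y(r) = exp(b·ω(r) − c′·r) S(r) y₀. -/
open MeasureTheory Filter Set Topology

lemma aux_cdf (ν : ℕ → Measure ℝ) [∀ n, IsFiniteMeasure (ν n)] (μ : Measure ℝ) [IsFiniteMeasure μ]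
    (hweak : ∀ g : ℝ → ℝ, Continuous g → (∃ M : ℝ, ∀ x, |g x| ≤ M) →
      Tendsto (fun n => ∫ x, g x ∂(ν n)) atTop (𝓝 (∫ x, g x ∂μ)))
    (hG : Continuous (fun s => μ.real (Iic s))) (s : ℝ) :
    Tendsto (fun n => (ν n).real (Iic s)) atTop (𝓝 (μ.real (Iic s))) := by
  -- trapezoidal functions
  have key : ∀ u v : ℝ, u < v → ∃ g : ℝ → ℝ, Continuous g ∧ (∃ M : ℝ, ∀ x, |g x| ≤ M) ∧
      ∀ (κ : Measure ℝ) [IsFiniteMeasure κ], κ.real (Iic u) ≤ ∫ x, g x ∂κ ∧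
        ∫ x, g x ∂κ ≤ κ.real (Iic v) := by
    intro u v huv
    have hc : Continuous (fun x : ℝ => max 0 (min 1 ((v - x) / (v - u)))) := by fun_prop
    have hb : ∀ x : ℝ, |max 0 (min 1 ((v - x) / (v - u)))| ≤ 1 := by
      intro x
      rw [abs_of_nonneg (le_max_left _ _)]
      exact max_le zero_le_one (min_le_left _ _)
    refine ⟨fun x => max 0 (min 1 ((v - x) / (v - u))), hc, ⟨1, hb⟩, ?_⟩
    intro κ _
    have hi : Integrable (fun x : ℝ => max 0 (min 1 ((v - x) / (v - u)))) κ :=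
      Integrable.of_bound hc.aestronglyMeasurable 1 (Eventually.of_forall hb)
    have hind : ∀ w : ℝ, Integrable ((Iic w).indicator (fun _ => (1:ℝ))) κ := fun w =>
      (integrable_const 1).indicator measurableSet_Iic
    have hint : ∀ w : ℝ, ∫ x, (Iic w).indicator (fun _ => (1:ℝ)) x ∂κ = κ.real (Iic w) := by
      intro w
      rw [integral_indicator measurableSet_Iic]; simp
    constructor
    · rw [← hint]
      refine integral_mono (hind u) hi fun x => ?_
      by_cases hx : x ≤ u
      · have : 1 ≤ (v - x) / (v - u) := by
          rw [le_div_iff₀ (by linarith)]; linarith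
        simp [indicator, hx, this]
      · simp [indicator, hx]
    · rw [← hint]
      refine integral_mono hi (hind v) fun x => ?_
      by_cases hx : x ≤ v
      · simp [indicator, hx]
      · have : (v - x) / (v - u) ≤ 0 := by
          apply div_nonpos_of_nonpos_of_nonneg <;> linarith
        simp [indicator, hx, this]
  rw [Metric.tendsto_atTop]
  intro ε hε
  obtain ⟨δ, hδ, hd⟩ := Metric.continuous_iff.1 hG s (ε/2) (by linarith)
  have h1 := hd (s + δ/2) (by rw [Real.dist_eq]; rw [abs_lt]; constructor <;> linarith)
  have h2 := hd (s - δ/2) (by rw [Real.dist_eq]; rw [abs_lt]; constructor <;> linarith)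
  obtain ⟨g1, c1, b1, e1⟩ := key s (s + δ/2) (by linarith)
  obtain ⟨g2, c2, b2, e2⟩ := key (s - δ/2) s (by linarith)
  obtain ⟨n1, hn1⟩ := Metric.tendsto_atTop.1 (hweak g1 c1 b1) (ε/2) (by linarith)
  obtain ⟨n2, hn2⟩ := Metric.tendsto_atTop.1 (hweak g2 c2 b2) (ε/2) (by linarith)
  refine ⟨max n1 n2, fun n hn => ?_⟩
  have a1 := hn1 n (le_trans (le_max_left _ _) hn)
  have a2 := hn2 n (le_trans (le_max_right _ _) hn)
  have f1 := e1 (ν n)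
  have f2 := e2 (ν n)
  have f3 := e1 μ
  have f4 := e2 μ
  rw [Real.dist_eq, abs_lt] at *
  constructor <;> linarith [f1.1, f2.2, f3.2, f4.1]

/-- Riemann approximation for an arbitrary finite measure. -/
lemma aux_riem {E : Type*} [NormedAddCommGroup E] [NormedSpace ℝ E] [CompleteSpace E]
    (h : ℝ → E) (hh : Continuous h) (κ : Measure ℝ) [IsFiniteMeasure κ]
    (u : ℕ → ℝ) (hu : Monotone u) (m : ℕ) (ε : ℝ) 
    (hε : ∀ i < m, ∀ x ∈ Ioc (u i) (u (i+1)), ‖h x - h (u i)‖ ≤ ε) :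
    ‖(∫ x in (u 0)..(u m), h x ∂κ) - ∑ i ∈ Finset.range m, κ.real (Ioc (u i) (u (i+1))) • h (u i)‖
      ≤ ε * κ.real (Ioc (u 0) (u m)) := by
  have hii : ∀ a b, IntervalIntegrable h κ a b := fun a b => hh.intervalIntegrable a b
  rw [← intervalIntegral.sum_integral_adjacent_intervals (fun k _ => hii _ _),
    ← Finset.sum_sub_distrib]
  have hm : κ.real (Ioc (u 0) (u m)) = ∑ i ∈ Finset.range m, κ.real (Ioc (u i) (u (i+1))) := by
    have := intervalIntegral.sum_integral_adjacent_intervals (μ := κ) (a := u) (n := m) (f := fun _ => (1:ℝ))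
      (fun k _ => intervalIntegrable_const)
    rw [intervalIntegral.integral_of_le (hu (Nat.zero_le m))] at this
    simp only [intervalIntegral.integral_of_le (hu (Nat.le_succ _))] at this
    simpa using this.symm
  rw [hm, Finset.mul_sum]
  refine norm_sum_le_of_le _ fun i hi => ?_
  have hle := hu (Nat.le_succ i)
  have : κ.real (Ioc (u i) (u (i+1))) • h (u i) = ∫ x in (u i)..(u (i+1)), h (u i) ∂κ := by
    rw [intervalIntegral.integral_of_le hle]; simp
  rw [this, ← intervalIntegral.integral_sub (hii _ _) intervalIntegrable_const,
    intervalIntegral.integral_of_le hle]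
  exact norm_setIntegral_le_of_norm_le_const (measure_lt_top _ _) (hε i (Finset.mem_range.1 hi))

lemma aux_conv {E : Type*} [NormedAddCommGroup E] [NormedSpace ℝ E] [CompleteSpace E]
    (h : ℝ → E) (hh : Continuous h)
    (ν : ℕ → Measure ℝ) [∀ n, IsFiniteMeasure (ν n)] (μ : Measure ℝ) [IsFiniteMeasure μ]
    (hF : ∀ s, Tendsto (fun n => (ν n).real (Iic s)) atTop (𝓝 (μ.real (Iic s))))
    (a t : ℝ) (hat : a ≤ t) :
    Tendsto (fun n => ∫ x in a..t, h x ∂(ν n)) atTop (𝓝 (∫ x in a..t, h x ∂μ)) := by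
  have hI : ∀ u v, u ≤ v → Tendsto (fun n => (ν n).real (Ioc u v)) atTop (𝓝 (μ.real (Ioc u v))) := by
    intro u v huv
    have : ∀ (κ : Measure ℝ) [IsFiniteMeasure κ], κ.real (Ioc u v) = κ.real (Iic v) - κ.real (Iic u) := by
      intro κ _
      have hdiff : Ioc u v = Iic v \ Iic u := by
        ext x; simp [and_comm]
      rw [hdiff, measureReal_sdiff (Iic_subset_Iic.2 huv) measurableSet_Iic]
    simp only [this]
    exact (hF v).sub (hF u)
  rw [Metric.tendsto_atTop]
  intro ε hε
  set M := μ.real (Ioc a t) with hM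
  have hM0 : 0 ≤ M := measureReal_nonneg
  set η := ε / (2 * (2 * M + 2)) with hη
  have hη0 : 0 < η := by positivity
  have huc := (isCompact_Icc (a := a) (b := t)).uniformContinuousOn_of_continuous hh.continuousOn
  obtain ⟨δ, hδ, hd⟩ := Metric.uniformContinuousOn_iff.1 huc η hη0
  obtain ⟨m, hm⟩ := exists_nat_gt ((t - a) / δ)
  have hm0 : (0:ℝ) < m := lt_of_le_of_lt (div_nonneg (by linarith) hδ.le) hm
  set u : ℕ → ℝ := fun i => a + i * ((t - a) / m) with hudef
  have hq : 0 ≤ (t - a) / m := div_nonneg (by linarith) hm0.le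
  have hq' : (t - a) / m < δ := by
    rw [div_lt_iff₀ hm0]; rw [div_lt_iff₀ hδ] at hm; linarith
  have hu : Monotone u := by
    intro i j hij
    simp only [hudef]
    have : (i:ℝ) ≤ j := by exact_mod_cast hij
    nlinarith
  have hu0 : u 0 = a := by simp [hudef]
  have hum : u m = t := by simp only [hudef]; field_simp; ring
  have hosc : ∀ i < m, ∀ x ∈ Ioc (u i) (u (i+1)), ‖h x - h (u i)‖ ≤ η := by
    intro i hi x hx
    have h1 : a ≤ u i := hu0 ▸ hu (Nat.zero_le i)
    have h2 : u (i+1) ≤ t := hum ▸ hu hi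
    have h3 : u (i+1) = u i + (t - a)/m := by simp only [hudef]; push_cast; ring
    rw [← dist_eq_norm]
    refine (hd x ⟨by linarith [hx.1], by linarith [hx.2]⟩ (u i) ⟨h1, by linarith [hx.1, hx.2]⟩ ?_).le
    rw [Real.dist_eq, abs_lt]; constructor <;> linarith [hx.1, hx.2]
  have hsum : Tendsto (fun n => ∑ i ∈ Finset.range m, (ν n).real (Ioc (u i) (u (i+1))) • h (u i)) atTop
      (𝓝 (∑ i ∈ Finset.range m, μ.real (Ioc (u i) (u (i+1))) • h (u i))) :=
    tendsto_finsetSum _ fun i _ => (hI _ _ (hu (Nat.le_succ i))).smul_const _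
  obtain ⟨n1, hn1⟩ := Metric.tendsto_atTop.1 hsum (ε/2) (by linarith)
  obtain ⟨n2, hn2⟩ := Metric.tendsto_atTop.1 (hI a t hat) 1 one_pos
  refine ⟨max n1 n2, fun n hn => ?_⟩
  have a1 := hn1 n (le_trans (le_max_left _ _) hn)
  have a2 := hn2 n (le_trans (le_max_right _ _) hn)
  have r1 := aux_riem h hh (ν n) u hu m η hosc
  have r2 := aux_riem h hh μ u hu m η hosc
  rw [hu0, hum, ← dist_eq_norm] at r1 r2
  rw [Real.dist_eq, abs_lt] at a2
  have e1 : η * (ν n).real (Ioc a t) ≤ η * (M + 1) :=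
    mul_le_mul_of_nonneg_left (by linarith [a2.2]) hη0.le
  have e2 : η * (M + 1) + η * M < ε / 2 := by
    have : η * (2 * M + 2) = ε / 2 := by rw [hη]; field_simp
    nlinarith
  rw [dist_comm] at r2
  have := dist_triangle4 (∫ x in a..t, h x ∂(ν n)) _ _ (∫ x in a..t, h x ∂μ) |>.trans
    (add_le_add (add_le_add r1 a1.le) r2)
  linarith

lemma aux_meas (μ : Measure ℝ) [IsFiniteMeasure μ] (c : ℝ) (hc : 0 ≤ c)
    (hz : μ (Icc 0 1)ᶜ = 0)
    (hvar : ∀ t ∈ Icc (0 : ℝ) 1, μ (Icc 0 t) = ENNReal.ofReal (c * t)) :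
    μ = ENNReal.ofReal c • (volume.restrict (Icc (0:ℝ) 1)) := by
  apply Measure.ext_of_Iic
  intro s
  have h1 : Iic s ∩ Icc (0:ℝ) 1 = Icc 0 (min s 1) := by
    ext x; simp only [mem_inter_iff, mem_Iic, mem_Icc, le_min_iff]; tauto
  rw [Measure.smul_apply, Measure.restrict_apply measurableSet_Iic, h1, smul_eq_mul,
    ← measure_inter_conull hz, h1]
  rcases lt_or_ge (min s 1) 0 with h | h
  · simp [Icc_eq_empty (not_le.2 h)]
  · rw [hvar _ ⟨h, min_le_right _ _⟩, Real.volume_Icc, sub_zero, ENNReal.ofReal_mul hc]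

lemma IntervalPartition.le_of_le {a b : ℝ} (P : IntervalPartition a b) {i j : ℕ} (hij : i ≤ j)
    (hj : j ≤ P.N) : P.t i ≤ P.t j := by
  induction j, hij using Nat.le_induction with
  | base => exact le_rfl
  | succ k hk ih => exact (ih (by omega)).trans (P.mono k (by omega)).le

lemma IntervalPartition.mem {a b : ℝ} (P : IntervalPartition a b) {j : ℕ}
    (hj : j ≤ P.N) : P.t j ∈ Icc a b :=
  ⟨P.first.symm.le.trans (P.le_of_le (Nat.zero_le j) hj), (P.le_of_le hj le_rfl).trans P.last.le⟩

/-- At most one partition interval contains `t`. -/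
lemma IntervalPartition.norm_sum_le {a b : ℝ} (P : IntervalPartition a b) {E : Type*}
    [NormedAddCommGroup E] (f : ℕ → E) (t K : ℝ) (hK : 0 ≤ K)
    (h1 : ∀ j < P.N, P.t (j+1) ≤ t → f j = 0) (h2 : ∀ j < P.N, t < P.t j → f j = 0)
    (h3 : ∀ j < P.N, ‖f j‖ ≤ K) : ‖∑ j ∈ Finset.range P.N, f j‖ ≤ K := by
  by_cases hex : ∃ j < P.N, P.t j ≤ t ∧ t < P.t (j+1)
  · obtain ⟨j, hj, hj1, hj2⟩ := hex
    rw [Finset.sum_eq_single j]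
    · exact h3 j hj
    · intro i hi hij
      have hi := Finset.mem_range.1 hi
      rcases lt_or_gt_of_ne hij with h | h
      · exact h1 i hi ((P.le_of_le h hj.le).trans hj1)
      · exact h2 i hi (hj2.trans_le (P.le_of_le h hi.le))
    · intro hn
      exact absurd (Finset.mem_range.2 hj) hn
  · push Not at hex
    rw [Finset.sum_eq_zero]
    · simpa using hK
    · intro i hi
      have hi := Finset.mem_range.1 hi
      rcases lt_or_ge t (P.t i) with h | h
      · exact h2 i hi h
      · exact h1 i hi (hex i hi h)

lemma aux_osc (π : ℕ → IntervalPartition 0 1)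
    (hmesh : ∀ ε > 0, ∃ n₀ : ℕ, ∀ n ≥ n₀, ∀ i < (π n).N, (π n).t (i + 1) - (π n).t i < ε)
    {E : Type*} [NormedAddCommGroup E]
    (ω : ℝ → E) (hω : ContinuousOn ω (Icc 0 1)) (t : ℝ) (ht : t ∈ Icc (0:ℝ) 1) (ε : ℝ) (hε : 0 < ε) :
    ∀ᶠ n in atTop, ∀ j < (π n).N, ∀ r ∈ Icc (min ((π n).t j) t) (min ((π n).t (j + 1)) t),
      ‖ω (min ((π n).t (j + 1)) t) - ω r‖ < ε := by
  have huc := (isCompact_Icc (a := (0:ℝ)) (b := 1)).uniformContinuousOn_of_continuous hω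
  obtain ⟨δ, hδ, hd⟩ := Metric.uniformContinuousOn_iff.1 huc ε hε
  obtain ⟨n0, hn0⟩ := hmesh δ hδ
  filter_upwards [eventually_ge_atTop n0] with n hn j hj r hr
  have m1 := (π n).mem hj.le
  have m2 := (π n).mem (j := j+1) hj
  have h := hn0 n hn j hj
  have h0 : 0 ≤ min ((π n).t j) t := le_min m1.1 ht.1
  have h1 : min ((π n).t (j+1)) t ≤ 1 := (min_le_right _ _).trans ht.2
  have h3 : min ((π n).t (j+1)) t - min ((π n).t j) t < δ := by
    have := (π n).mono j hj
    rcases le_total ((π n).t j) t with h4 | h4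
    · rw [min_eq_left h4]; linarith [min_le_left ((π n).t (j+1)) t]
    · rw [min_eq_right h4]; linarith [min_le_right ((π n).t (j+1)) t]
  rw [← dist_eq_norm]
  refine hd _ ⟨by linarith [hr.1, hr.2], h1⟩ r ⟨by linarith [hr.1], by linarith [hr.2]⟩ ?_
  rw [Real.dist_eq, abs_lt]; constructor <;> linarith [hr.1, hr.2]

lemma aux_zero (μ : Measure ℝ) [IsFiniteMeasure μ] (π : ℕ → IntervalPartition 0 1) 
    (A : ℕ → ℕ → ℝ)
    (hweak : ∀ g : ℝ → ℝ, Continuous g → (∃ M : ℝ, ∀ x, |g x| ≤ M) →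
      Tendsto (fun n => ∑ j ∈ Finset.range (π n).N, A n j * g ((π n).t j)) atTop
        (𝓝 (∫ x, g x ∂μ))) : μ (Icc 0 1)ᶜ = 0 := by
  set g : ℝ → ℝ := fun x => min 1 (max (-x) 0 + max (x - 1) 0) with hg
  have hgc : Continuous g := by fun_prop
  have hg0 : ∀ x, 0 ≤ g x := fun x => le_min zero_le_one (by positivity)
  have hgb : ∀ x, |g x| ≤ 1 := fun x => by rw [abs_of_nonneg (hg0 x)]; exact min_le_left _ _
  have h := hweak g hgc ⟨1, hgb⟩
  have hz : ∀ n, ∑ j ∈ Finset.range (π n).N, A n j * g ((π n).t j) = 0 := by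
    intro n
    refine Finset.sum_eq_zero fun j hj => ?_
    have m := (π n).mem (Finset.mem_range.1 hj).le
    have : g ((π n).t j) = 0 := by
      simp only [hg]
      rw [max_eq_right (by linarith [m.1]), max_eq_right (by linarith [m.2])]; simp
    rw [this, mul_zero]
  simp only [hz] at h
  have h0 : ∫ x, g x ∂μ = 0 := (tendsto_nhds_unique h tendsto_const_nhds)
  have hi : Integrable g μ := Integrable.of_bound hgc.aestronglyMeasurable 1 (Eventually.of_forall hgb)
  have hae := (integral_eq_zero_iff_of_nonneg hg0 hi).1 h0
  refine measure_mono_null ?_ (ae_iff.1 hae)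
  intro x hx hgx
  apply hx
  simp only [Pi.zero_apply, hg] at hgx
  rcases min_choice 1 (max (-x) 0 + max (x - 1) 0) with h | h
  · rw [h] at hgx; norm_num at hgx
  · rw [h] at hgx
    constructor <;> linarith [le_max_left (-x) 0, le_max_left (x-1) 0, le_max_right (-x) 0, le_max_right (x-1) 0]

lemma aux_sum {E : Type*} [NormedAddCommGroup E] [NormedSpace ℝ E] [CompleteSpace E]
    (h : ℝ → E) (hh : Continuous h) (N : ℕ) (A : ℕ → ℝ) (hA : ∀ j, 0 ≤ A j) (τ : ℕ → ℝ)
    (s : Set ℝ) [DecidablePred (· ∈ s)] (hs : MeasurableSet s) :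
    ∫ x in s, h x ∂(∑ j ∈ Finset.range N, ENNReal.ofReal (A j) • Measure.dirac (τ j))
      = ∑ j ∈ Finset.range N, if τ j ∈ s then A j • h (τ j) else 0 := by
  have hm : StronglyMeasurable (s.indicator h) := hh.stronglyMeasurable.indicator hs
  rw [← integral_indicator hs, integral_finsetSum_measure]
  · refine Finset.sum_congr rfl fun j _ => ?_
    rw [integral_smul_measure, integral_dirac, ENNReal.toReal_ofReal (hA j), indicator]
    split_ifs <;> simp
  · intro j _
    refine Integrable.smul_measure ?_ ENNReal.ofReal_ne_top
    exact (integrable_dirac (by simp))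

lemma aux_stop (p : ℕ) (hp : 0 < p) 
    (π : ℕ → IntervalPartition 0 1)
    (hmesh : ∀ ε > 0, ∃ n₀ : ℕ, ∀ n ≥ n₀, ∀ i < (π n).N, (π n).t (i + 1) - (π n).t i < ε)
    (ω : ℝ → ℝ) (hω : ContinuousOn ω (Icc 0 1))
    (c : ℝ) (hc : 0 ≤ c)
    (μ : Measure ℝ) [IsFiniteMeasure μ]
    (hweak : ∀ g : ℝ → ℝ, Continuous g → (∃ M : ℝ, ∀ x, |g x| ≤ M) →
      Tendsto (fun n => ∑ j ∈ Finset.range (π n).N,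
          |ω ((π n).t (j + 1)) - ω ((π n).t j)| ^ p * g ((π n).t j)) atTop
        (𝓝 (∫ x, g x ∂μ)))
    (hvar : ∀ t ∈ Icc (0 : ℝ) 1, μ (Icc 0 t) = ENNReal.ofReal (c * t))
    {E : Type*} [NormedAddCommGroup E] [NormedSpace ℝ E] [CompleteSpace E]
    (h : ℝ → E) (hh : Continuous h) (t : ℝ) (ht : t ∈ Ioc (0:ℝ) 1) :
    Tendsto (fun n => ∑ j ∈ Finset.range (π n).N,
          |ω (min ((π n).t (j + 1)) t) - ω (min ((π n).t j) t)| ^ p • h ((π n).t j)) atTop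
        (𝓝 (c • ∫ x in (0:ℝ)..t, h x)) := by
  have hz := aux_zero μ π _ hweak
  have hμ := aux_meas μ c hc hz hvar
  set ν : ℕ → Measure ℝ := fun n => ∑ j ∈ Finset.range (π n).N,
    ENNReal.ofReal (|ω ((π n).t (j + 1)) - ω ((π n).t j)| ^ p) • Measure.dirac ((π n).t j) with hν
  have hfin : ∀ n, IsFiniteMeasure (ν n) := by
    intro n
    constructor
    simp only [hν, Measure.finsetSum_apply, Measure.smul_apply]
    simp
  have hG : Continuous (fun s => μ.real (Iic s)) := by
    have : ∀ s, μ.real (Iic s) = c * max 0 (min s 1) := by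
      intro s
      have h1 : Iic s ∩ Icc (0:ℝ) 1 = Icc 0 (min s 1) := by
        ext x; simp only [mem_inter_iff, mem_Iic, mem_Icc, le_min_iff]; tauto
      rw [hμ, measureReal_def, Measure.smul_apply, Measure.restrict_apply measurableSet_Iic, h1,
        smul_eq_mul, Real.volume_Icc, ENNReal.toReal_mul, ENNReal.toReal_ofReal hc, sub_zero,
        ENNReal.toReal_ofReal', max_comm]
    simp only [this]
    fun_prop
  have hw : ∀ g : ℝ → ℝ, Continuous g → (∃ M : ℝ, ∀ x, |g x| ≤ M) →
      Tendsto (fun n => ∫ x, g x ∂(ν n)) atTop (𝓝 (∫ x, g x ∂μ)) := by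
    intro g hg hb
    have := hweak g hg hb
    refine this.congr fun n => ?_
    have h2 := aux_sum g hg (π n).N (fun j => |ω ((π n).t (j + 1)) - ω ((π n).t j)| ^ p)
      (fun j => by positivity) (π n).t univ MeasurableSet.univ
    rw [Measure.restrict_univ] at h2
    simp only [hν]
    rw [h2]
    simp
  have hF := aux_cdf ν μ hw hG
  have hconv := aux_conv h hh ν μ hF (-1) t (by linarith [ht.1])
  have hlim : ∫ x in (-1:ℝ)..t, h x ∂μ = c • ∫ x in (0:ℝ)..t, h x := by
    rw [intervalIntegral.integral_of_le (by linarith [ht.1]), intervalIntegral.integral_of_le ht.1.le,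
      hμ, Measure.restrict_smul, integral_smul_measure, ENNReal.toReal_ofReal hc,
      Measure.restrict_restrict measurableSet_Ioc, ← integral_Icc_eq_integral_Ioc (x := 0)]
    congr 3
    ext x
    simp only [mem_inter_iff, mem_Ioc, mem_Icc]
    constructor
    · rintro ⟨⟨_, h2⟩, h3, _⟩; exact ⟨h3, h2⟩
    · rintro ⟨h1, h2⟩; exact ⟨⟨by linarith, h2⟩, h1, h2.trans ht.2⟩
  rw [hlim] at hconv
  -- compare stopped and unstopped sums
  suffices hdiff : Tendsto (fun n => (∑ j ∈ Finset.range (π n).N,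
          |ω (min ((π n).t (j + 1)) t) - ω (min ((π n).t j) t)| ^ p • h ((π n).t j)) 
          - ∫ x in (-1:ℝ)..t, h x ∂(ν n)) atTop (𝓝 0) by
    have := hdiff.add hconv
    simpa using this
  obtain ⟨C, hC⟩ := (isCompact_Icc (a := (0:ℝ)) (b := 1)).exists_bound_of_continuousOn hh.continuousOn
  have hC0 : 0 ≤ C := (norm_nonneg _).trans (hC 0 (by simp))
  rw [Metric.tendsto_nhds]
  intro ε hε
  set η := min 1 (ε / (2 * (C + 1))) with hη
  have hη0 : 0 < η := by positivity
  have hη1 : η ≤ 1 := min_le_left _ _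
  have hη2 : η * (2 * (C + 1)) ≤ ε := by
    rw [← le_div_iff₀ (by positivity)]; exact min_le_right _ _
  filter_upwards [aux_osc π hmesh ω hω t ⟨ht.1.le, ht.2⟩ η hη0,
    aux_osc π hmesh ω hω 1 (by simp) η hη0] with n h1 h2
  rw [intervalIntegral.integral_of_le (by linarith [ht.1])]
  classical
  rw [aux_sum h hh (π n).N (fun j => |ω ((π n).t (j + 1)) - ω ((π n).t j)| ^ p)
      (fun j => by positivity) (π n).t (Ioc (-1) t) measurableSet_Ioc, ← Finset.sum_sub_distrib, dist_zero_right]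
  refine lt_of_le_of_lt ((π n).norm_sum_le _ t (η * (2 * C)) (by positivity) ?_ ?_ ?_) (by nlinarith)
  · intro j hj hjt
    have hm := (π n).mono j hj
    have m1 := (π n).mem hj.le
    rw [min_eq_left hjt, min_eq_left (by linarith), if_pos ⟨by linarith [m1.1], by linarith⟩, sub_self]
  · intro j hj hjt
    have hm := (π n).mono j hj
    rw [min_eq_right hjt.le, min_eq_right (by linarith), if_neg (fun hx => by linarith [hx.2])]
    simp [hp.ne']
  · intro j hj
    have hm := (π n).mono j hj
    have m1 := (π n).mem hj.le
    have m2 := (π n).mem (j := j+1) hj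
    have b1 := h1 j hj _ (left_mem_Icc.2 (min_le_min_right t hm.le))
    have b2 := h2 j hj _ (left_mem_Icc.2 (min_le_min_right 1 hm.le))
    rw [min_eq_left m1.2, min_eq_left m2.2] at b2
    have key : ∀ x : ℝ, ‖x‖ < η → ‖|x| ^ p • h ((π n).t j)‖ ≤ η * C := by
      intro x hx
      rw [norm_smul, norm_pow, Real.norm_eq_abs, abs_abs]
      rw [Real.norm_eq_abs] at hx
      have : |x| ^ p ≤ η := by
        calc |x| ^ p ≤ |x| ^ 1 := pow_le_pow_of_le_one (abs_nonneg _) (by linarith) hp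
          _ ≤ η := by rw [pow_one]; exact hx.le
      exact mul_le_mul this (hC _ m1) (norm_nonneg _) hη0.le
    have k1 := key _ b1
    have k2 := key _ b2
    refine (norm_sub_le _ _).trans ?_
    have k3 : ‖(if (π n).t j ∈ Ioc (-1) t then 
        |ω ((π n).t (j + 1)) - ω ((π n).t j)| ^ p • h ((π n).t j) else 0)‖ ≤ η * C := by
      split_ifs
      · exact k2
      · simp; positivity
    linarith

lemma aux_first (π : ℕ → IntervalPartition 0 1)
    (hmesh : ∀ ε > 0, ∃ n₀ : ℕ, ∀ n ≥ n₀, ∀ i < (π n).N, (π n).t (i + 1) - (π n).t i < ε)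
    {E : Type*} [NormedAddCommGroup E] [NormedSpace ℝ E] [CompleteSpace E]
    (e : ℝ → ℝ) (he : ContinuousOn e (Icc 0 1)) (F F' : ℝ → E) (hF' : ContinuousOn F' (Icc 0 1))
    (hF : ∀ s ∈ Icc (0:ℝ) 1, HasDerivWithinAt F (F' s) (Icc (0:ℝ) 1) s)
    (t : ℝ) (ht : t ∈ Ioc (0:ℝ) 1) :
    Tendsto (fun n => ∑ j ∈ Finset.range (π n).N, e (min ((π n).t (j + 1)) t) •
      (F (min ((π n).t (j + 1)) t) - F (min ((π n).t j) t))) atTop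
      (𝓝 (∫ r in (0:ℝ)..t, e r • F' r)) := by
  obtain ⟨C, hC⟩ := (isCompact_Icc (a := (0:ℝ)) (b := 1)).exists_bound_of_continuousOn hF'
  have hC0 : 0 ≤ C := (norm_nonneg _).trans (hC 0 (by simp))
  have hftc : ∀ u v, 0 ≤ u → u ≤ v → v ≤ 1 → F v - F u = ∫ r in u..v, F' r := by
    intro u v hu huv hv
    symm
    have hsub : Icc u v ⊆ Icc 0 1 := Icc_subset_Icc hu hv
    refine intervalIntegral.integral_eq_sub_of_hasDeriv_right_of_le huv ?_ ?_ ?_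
    · exact fun x hx => ((hF x (hsub hx)).continuousWithinAt).mono hsub
    · intro x hx
      have hx' : Icc (0:ℝ) 1 ∈ 𝓝 x := Icc_mem_nhds (by linarith [hx.1]) (by linarith [hx.2])
      exact ((hF x (hsub (Ioo_subset_Icc_self hx))).hasDerivAt hx').hasDerivWithinAt
    · exact (hF'.mono hsub).intervalIntegrable_of_Icc huv
  rw [Metric.tendsto_nhds]
  intro ε hε
  have hη0 : 0 < ε / (C + 1) := by positivity
  filter_upwards [aux_osc π hmesh e he t ⟨ht.1.le, ht.2⟩ (ε / (C + 1)) hη0] with n hn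
  have hs0 : min ((π n).t 0) t = 0 := by rw [(π n).first]; exact min_eq_left ht.1.le
  have hsN : min ((π n).t (π n).N) t = t := by rw [(π n).last]; exact min_eq_right ht.2
  have hmono : ∀ j < (π n).N, 0 ≤ min ((π n).t j) t ∧ min ((π n).t j) t ≤ min ((π n).t (j+1)) t ∧
      min ((π n).t (j+1)) t ≤ 1 := fun j hj =>
    ⟨le_min ((π n).mem hj.le).1 ht.1.le, min_le_min_right t ((π n).mono j hj).le,
      (min_le_right _ _).trans ht.2⟩
  have hcont : ContinuousOn (fun r => e r • F' r) (Icc 0 1) := he.smul hF'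
  have hsplit := intervalIntegral.sum_integral_adjacent_intervals (μ := volume)
    (a := fun j => min ((π n).t j) t) (n := (π n).N) (f := fun r => e r • F' r) (fun j hj => by
      obtain ⟨h1, h2, h3⟩ := hmono j hj
      exact (hcont.mono (Icc_subset_Icc h1 h3)).intervalIntegrable_of_Icc h2)
  simp only [hs0, hsN] at hsplit
  rw [← hsplit, dist_eq_norm, ← Finset.sum_sub_distrib]
  have hb : ‖∑ j ∈ Finset.range (π n).N, (e (min ((π n).t (j + 1)) t) •
      (F (min ((π n).t (j + 1)) t) - F (min ((π n).t j) t)) -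
      ∫ r in (min ((π n).t j) t)..(min ((π n).t (j+1)) t), e r • F' r)‖ ≤
      ∑ j ∈ Finset.range (π n).N, (ε / (C+1) * C) * (min ((π n).t (j + 1)) t - min ((π n).t j) t) := by
    refine norm_sum_le_of_le _ fun j hj => ?_
    have hj := Finset.mem_range.1 hj
    obtain ⟨h1, h2, h3⟩ := hmono j hj
    have hsub := Icc_subset_Icc h1 h3
    rw [hftc _ _ h1 h2 h3, ← intervalIntegral.integral_smul, ← intervalIntegral.integral_sub]
    · refine (intervalIntegral.norm_integral_le_of_norm_le_const (C := ε / (C+1) * C) ?_).trans ?_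
      · intro r hr
        rw [uIoc_of_le h2] at hr
        have hr' := Ioc_subset_Icc_self hr
        rw [← sub_smul, norm_smul]
        exact mul_le_mul (hn j hj r hr').le (hC r (hsub hr')) (norm_nonneg _) hη0.le
      · rw [abs_of_nonneg (by linarith)]
    · exact (((hF'.mono hsub).const_smul _)).intervalIntegrable_of_Icc h2
    · exact (hcont.mono hsub).intervalIntegrable_of_Icc h2
  refine hb.trans_lt ?_
  rw [← Finset.mul_sum, Finset.sum_range_sub (fun j => min ((π n).t j) t), hs0, hsN]
  have h1 : ε / (C+1) * C < ε := by
    rw [div_mul_eq_mul_div, div_lt_iff₀ (by positivity)]; linarith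
  have h2 : 0 ≤ ε / (C+1) * C := by positivity
  nlinarith [ht.1, ht.2]

lemma aux_taylor (p : ℕ) (hp : 0 < p) (hpeven : Even p) (b Δ : ℝ) (hΔ : |b * Δ| ≤ 1) :
    |(Real.exp (b * Δ) - 1) - (∑ k ∈ Finset.Icc 1 (p - 1), (b ^ k / (k.factorial : ℝ)) * Δ ^ k)
      - b ^ p / (p.factorial : ℝ) * |Δ| ^ p| ≤ 
      |b * Δ| ^ (p+1) * (((p+1 : ℕ).succ : ℝ) / (((p+1).factorial : ℝ) * ((p+1 : ℕ):ℝ))) := by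
  have h := Real.exp_bound hΔ (Nat.succ_pos p)
  have hs : ∑ m ∈ Finset.range p.succ, (b * Δ) ^ m / (m.factorial : ℝ) =
      1 + (∑ k ∈ Finset.Icc 1 (p - 1), (b ^ k / (k.factorial : ℝ)) * Δ ^ k)
        + b ^ p / (p.factorial : ℝ) * |Δ| ^ p := by
    rw [hpeven.pow_abs, Finset.sum_range_succ]
    obtain ⟨q, rfl⟩ : ∃ q, p = q + 1 := ⟨p - 1, by omega⟩
    rw [Finset.range_eq_Ico, Finset.sum_eq_sum_Ico_succ_bot (Nat.succ_pos q)]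
    have : Finset.Ico (0+1) (q+1) = Finset.Icc 1 (q + 1 - 1) := by
      ext x; simp only [Finset.mem_Ico, Finset.mem_Icc]; omega
    rw [this]
    congr 1
    · congr 1
      · simp
      · exact Finset.sum_congr rfl fun k _ => by rw [mul_pow]; ring
    · rw [mul_pow]; ring
  rw [hs] at h
  convert h using 2
  ring

/-- for a strongly continuous semigroup `S` with generator `A` (here encoded by
`x₀` being in the domain of the generator with `A x₀ = y₀`, i.e. `d/dt S(t)x₀ = S(t)y₀`), the
function `Y(t) = exp(b·ω(t) − c′·t) S(t) x₀`, `c′ = (c/p!)·b^p`, is a strong solution of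
`dY = AY dt + bY d^π ω`, `Y(0) = x₀`, for a path `ω` of finite `p`-th variation along `π`
with `[ω]_p^π(t) = c·t`. -/
theorem statement13
    {V : Type*} [NormedAddCommGroup V] [InnerProductSpace ℝ V] [CompleteSpace V]
    (p : ℕ) (hp : 0 < p) (hpeven : Even p)
    (π : ℕ → IntervalPartition 0 1)
    (hmesh : ∀ ε > 0, ∃ n₀ : ℕ, ∀ n ≥ n₀, ∀ i < (π n).N, (π n).t (i + 1) - (π n).t i < ε)
    (ω : ℝ → ℝ) (hω : ContinuousOn ω (Icc 0 1)) (hω0 : ω 0 = 0)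
    (c : ℝ) (hc : 0 ≤ c)
    -- `ω` has finite `p`-th variation along `π` with limit measure `μ`, `[ω]_p^π(t) = c·t`:
    (μ : Measure ℝ) [IsFiniteMeasure μ] (hμna : ∀ x : ℝ, μ {x} = 0)
    (hweak : ∀ g : ℝ → ℝ, Continuous g → (∃ M : ℝ, ∀ x, |g x| ≤ M) →
      Tendsto (fun n => ∑ j ∈ Finset.range (π n).N,
          |ω ((π n).t (j + 1)) - ω ((π n).t j)| ^ p * g ((π n).t j)) atTop
        (𝓝 (∫ x, g x ∂μ)))
    (hvar : ∀ t ∈ Icc (0 : ℝ) 1, μ (Icc 0 t) = ENNReal.ofReal (c * t))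
    -- `S` is a strongly continuous semigroup of bounded linear operators on `V`:
    (S : ℝ → V →L[ℝ] V)
    (hS0 : S 0 = ContinuousLinearMap.id ℝ V)
    (hSadd : ∀ s t : ℝ, 0 ≤ s → 0 ≤ t → S (s + t) = (S s).comp (S t))
    (hScont : ∀ x : V, ContinuousOn (fun t : ℝ => S t x) (Ici 0))
    (b : ℝ) (hb : b ≠ 0)
    -- `x₀` is in the domain of the generator `A` of `S` and `y₀ = A x₀`:
    (x₀ y₀ : V)
    (hx₀ : ∀ t ∈ Icc (0 : ℝ) 1,
      HasDerivWithinAt (fun τ : ℝ => S τ x₀) (S t y₀) (Icc (0 : ℝ) 1) t)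
    (hx₀c : ContinuousOn (fun t : ℝ => S t y₀) (Icc (0 : ℝ) 1))
    (Y : ℝ → V)
    (hY : ∀ t : ℝ, Y t = Real.exp (b * ω t - (c / (p.factorial : ℝ) * b ^ p) * t) • S t x₀) :
    ∀ t ∈ Ioc (0 : ℝ) 1, ∃ I : V,
      Tendsto (fun n => ∑ j ∈ Finset.range (π n).N, ∑ k ∈ Finset.Icc 1 (p - 1),
          ((b ^ k / (k.factorial : ℝ)) *
            (ω (min ((π n).t (j + 1)) t) - ω (min ((π n).t j) t)) ^ k) • Y ((π n).t j))
        atTop (𝓝 I) ∧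
      Y t = x₀ + (∫ r in (0 : ℝ)..t,
          Real.exp (b * ω r - (c / (p.factorial : ℝ) * b ^ p) * r) • S r y₀) + I := by
  intro t ht
  set c' : ℝ := c / (p.factorial : ℝ) * b ^ p with hc'
  have htI : t ∈ Icc (0:ℝ) 1 := ⟨ht.1.le, ht.2⟩
  set e : ℝ → ℝ := fun s => Real.exp (b * ω s) with hedef
  set F : ℝ → V := fun s => Real.exp (-c' * s) • S s x₀ with hFdef
  set F' : ℝ → V := fun s => Real.exp (-c' * s) • (S s y₀ - c' • S s x₀) with hF'def
  have hSx : ContinuousOn (fun s => S s x₀) (Icc 0 1) := fun s hs => (hx₀ s hs).continuousWithinAt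
  have hexp : ContinuousOn (fun s : ℝ => Real.exp (-c' * s)) (Icc 0 1) := by fun_prop
  have he : ContinuousOn e (Icc 0 1) := Real.continuous_exp.comp_continuousOn (hω.const_smul b)
  have hF'c : ContinuousOn F' (Icc 0 1) := hexp.smul (hx₀c.sub (hSx.const_smul c'))
  have hFd : ∀ s ∈ Icc (0:ℝ) 1, HasDerivWithinAt F (F' s) (Icc (0:ℝ) 1) s := by
    intro s hs
    have h1 : HasDerivAt (fun s : ℝ => Real.exp (-c' * s)) (Real.exp (-c' * s) * (-c' * 1)) s :=
      ((hasDerivAt_id s).const_mul (-c')).exp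
    have := h1.hasDerivWithinAt.smul (hx₀ s hs)
    have heq : F' s = Real.exp (-c' * s) • (S s) y₀ +
        (Real.exp (-c' * s) * (-c' * 1)) • (S s) x₀ := by
      change Real.exp (-c' * s) • (S s y₀ - c' • S s x₀) = _
      module
    rw [heq]
    exact this
  have hYe : ∀ s, Y s = e s • F s := by
    intro s
    rw [hY, smul_smul, ← Real.exp_add]
    congr 2; ring
  have hFc : ContinuousOn F (Icc 0 1) := fun s hs => (hFd s hs).continuousWithinAt
  have hYc : ContinuousOn Y (Icc 0 1) := by
    have : Y = fun s => e s • F s := funext hYe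
    rw [this]; exact he.smul hFc
  set Z : ℝ → V := fun s => Y (max 0 (min s 1)) with hZ
  have hZc : Continuous Z := hYc.comp_continuous (by fun_prop)
    (fun s => ⟨le_max_left _ _, max_le zero_le_one (min_le_right _ _)⟩)
  have hZY : ∀ s ∈ Icc (0:ℝ) 1, Z s = Y s := by
    intro s hs
    simp only [hZ]
    rw [min_eq_left hs.2, max_eq_right hs.1]
  have hP := aux_stop p hp π hmesh ω hω c hc μ hweak hvar Z hZc t ht
  have hP1 := aux_stop p hp π hmesh ω hω c hc μ hweak hvar (fun _ => (1:ℝ)) continuous_const t ht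
  have hA := aux_first π hmesh e he F F' hF'c hFd t ht
  obtain ⟨M, hM⟩ := (isCompact_Icc (a := (0:ℝ)) (b := 1)).exists_bound_of_continuousOn hYc
  have hM0 : 0 ≤ M := (norm_nonneg _).trans (hM 0 (by simp))
  -- the Taylor remainder
  have hR : Tendsto (fun n => ∑ j ∈ Finset.range (π n).N,
      ((Real.exp (b * (ω (min ((π n).t (j + 1)) t) - ω (min ((π n).t j) t))) - 1)
        - (∑ k ∈ Finset.Icc 1 (p - 1), (b ^ k / (k.factorial : ℝ)) *
            (ω (min ((π n).t (j + 1)) t) - ω (min ((π n).t j) t)) ^ k)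
        - b ^ p / (p.factorial : ℝ) *
          |ω (min ((π n).t (j + 1)) t) - ω (min ((π n).t j) t)| ^ p) • Y ((π n).t j))
      atTop (𝓝 0) := by
    set K : ℝ := ((p+1 : ℕ).succ : ℝ) / (((p+1).factorial : ℝ) * ((p+1 : ℕ):ℝ)) with hK
    have hK0 : 0 ≤ K := by positivity
    set B : ℝ := |b| ^ (p+1) * K * M with hB
    have hB0 : 0 ≤ B := by positivity
    set L : ℝ := c • ∫ x in (0:ℝ)..t, (1:ℝ) with hL
    have hL0 : 0 ≤ L := by
      simp only [hL, intervalIntegral.integral_const, smul_eq_mul, sub_zero, mul_one]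
      exact mul_nonneg hc ht.1.le
    rw [Metric.tendsto_nhds]
    intro ε hε
    have hη0 : 0 < min (1 / |b|) (ε / ((B + 1) * (L + 1))) := by
      have : 0 < |b| := abs_pos.2 hb
      positivity
    set η := min (1 / |b|) (ε / ((B + 1) * (L + 1))) with hη
    have hη1 : |b| * η ≤ 1 := by
      have : 0 < |b| := abs_pos.2 hb
      have h2 : η ≤ 1 / |b| := min_le_left _ _
      rw [le_div_iff₀ this] at h2; linarith
    have hη2 : η * ((B + 1) * (L + 1)) ≤ ε := by
      rw [← le_div_iff₀ (by positivity)]; exact min_le_right _ _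
    filter_upwards [aux_osc π hmesh ω hω t htI η hη0, hP1.eventually_lt_const (lt_add_one L)]
      with n h1 h2
    rw [dist_zero_right]
    have hb2 : ∀ j ∈ Finset.range (π n).N,
      ‖((Real.exp (b * (ω (min ((π n).t (j + 1)) t) - ω (min ((π n).t j) t))) - 1)
        - (∑ k ∈ Finset.Icc 1 (p - 1), (b ^ k / (k.factorial : ℝ)) *
            (ω (min ((π n).t (j + 1)) t) - ω (min ((π n).t j) t)) ^ k)
        - b ^ p / (p.factorial : ℝ) *
          |ω (min ((π n).t (j + 1)) t) - ω (min ((π n).t j) t)| ^ p) • Y ((π n).t j)‖ ≤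
        (B * η) * (|ω (min ((π n).t (j + 1)) t) - ω (min ((π n).t j) t)| ^ p • (1:ℝ)) := by
      intro j hj
      have hj := Finset.mem_range.1 hj
      have hd := (h1 j hj _ (left_mem_Icc.2 (min_le_min_right t ((π n).mono j hj).le))).le
      rw [Real.norm_eq_abs] at hd
      generalize ω (min ((π n).t (j + 1)) t) - ω (min ((π n).t j) t) = Δ at hd
      have hbd : |b * Δ| ≤ 1 := by
        rw [abs_mul]
        exact (mul_le_mul_of_nonneg_left hd (abs_nonneg b)).trans hη1
      rw [norm_smul, Real.norm_eq_abs, smul_eq_mul, mul_one]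
      calc _ ≤ (|b * Δ| ^ (p+1) * K) * M :=
            mul_le_mul (aux_taylor p hp hpeven b Δ hbd) (hM _ ((π n).mem hj.le)) (norm_nonneg _)
              (by positivity)
        _ = B * |Δ| * |Δ| ^ p := by rw [abs_mul, mul_pow, hB]; ring
        _ ≤ (B * η) * |Δ| ^ p := by gcongr
    refine (norm_sum_le_of_le _ hb2).trans_lt ?_
    rw [← Finset.mul_sum]
    calc _ ≤ (B * η) * (L + 1) := mul_le_mul_of_nonneg_left h2.le (by positivity)
      _ < ε := by nlinarith [mul_pos hη0 (by linarith : 0 < L + 1)]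
  -- exact decomposition
  have hdec : ∀ n, ∑ j ∈ Finset.range (π n).N, ∑ k ∈ Finset.Icc 1 (p - 1),
          ((b ^ k / (k.factorial : ℝ)) *
            (ω (min ((π n).t (j + 1)) t) - ω (min ((π n).t j) t)) ^ k) • Y ((π n).t j) =
      (Y t - Y 0) - (∑ j ∈ Finset.range (π n).N, e (min ((π n).t (j + 1)) t) •
      (F (min ((π n).t (j + 1)) t) - F (min ((π n).t j) t))) 
      - (b ^ p / (p.factorial : ℝ)) • (∑ j ∈ Finset.range (π n).N,
          |ω (min ((π n).t (j + 1)) t) - ω (min ((π n).t j) t)| ^ p • Z ((π n).t j))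
      - ∑ j ∈ Finset.range (π n).N,
      ((Real.exp (b * (ω (min ((π n).t (j + 1)) t) - ω (min ((π n).t j) t))) - 1)
        - (∑ k ∈ Finset.Icc 1 (p - 1), (b ^ k / (k.factorial : ℝ)) *
            (ω (min ((π n).t (j + 1)) t) - ω (min ((π n).t j) t)) ^ k)
        - b ^ p / (p.factorial : ℝ) *
          |ω (min ((π n).t (j + 1)) t) - ω (min ((π n).t j) t)| ^ p) • Y ((π n).t j) := by
    intro n
    have hs0 : min ((π n).t 0) t = 0 := by rw [(π n).first]; exact min_eq_left ht.1.le
    have hsN : min ((π n).t (π n).N) t = t := by rw [(π n).last]; exact min_eq_right ht.2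
    have htel := Finset.sum_range_sub (fun j => Y (min ((π n).t j) t)) (π n).N
    simp only [hs0, hsN] at htel
    rw [← htel, Finset.smul_sum, ← Finset.sum_sub_distrib, ← Finset.sum_sub_distrib,
      ← Finset.sum_sub_distrib]
    refine Finset.sum_congr rfl fun j hj => ?_
    have hj := Finset.mem_range.1 hj
    rw [hZY _ ((π n).mem hj.le), ← Finset.sum_smul]
    have hstep : Y (min ((π n).t (j + 1)) t) - Y (min ((π n).t j) t) -
        e (min ((π n).t (j + 1)) t) • (F (min ((π n).t (j + 1)) t) - F (min ((π n).t j) t)) =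
        (Real.exp (b * (ω (min ((π n).t (j + 1)) t) - ω (min ((π n).t j) t))) - 1) •
          Y ((π n).t j) := by
      have h1 : (Real.exp (b * (ω (min ((π n).t (j + 1)) t) - ω (min ((π n).t j) t))) - 1) •
          Y ((π n).t j) = 
          (Real.exp (b * (ω (min ((π n).t (j + 1)) t) - ω (min ((π n).t j) t))) - 1) •
          Y (min ((π n).t j) t) := by
        rcases le_total ((π n).t j) t with h | h
        · rw [min_eq_left h]
        · rw [min_eq_right h, min_eq_right (h.trans ((π n).mono j hj).le)]; simp
      have h2 : e (min ((π n).t (j + 1)) t) = 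
          Real.exp (b * (ω (min ((π n).t (j + 1)) t) - ω (min ((π n).t j) t))) *
            e (min ((π n).t j) t) := by
        simp only [hedef]
        rw [← Real.exp_add]; congr 1; ring
      rw [h1, hYe, hYe, h2]
      module
    rw [hstep]
    module
  refine ⟨(Y t - Y 0) - (∫ r in (0:ℝ)..t, e r • F' r)
    - (b ^ p / (p.factorial : ℝ)) • (c • ∫ x in (0:ℝ)..t, Z x) - 0, ?_, ?_⟩
  · simp only [hdec]
    exact ((tendsto_const_nhds.sub hA).sub (hP.const_smul _)).sub hR
  · have hY0 : Y 0 = x₀ := by rw [hY, hω0, hS0]; simp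
    have hsub : Icc 0 t ⊆ Icc (0:ℝ) 1 := Icc_subset_Icc le_rfl ht.2
    have hint : (∫ r in (0 : ℝ)..t, Real.exp (b * ω r - c' * r) • S r y₀) =
        (∫ r in (0:ℝ)..t, e r • F' r) + (b ^ p / (p.factorial : ℝ)) • (c • ∫ x in (0:ℝ)..t, Z x) := by
      rw [smul_smul, ← intervalIntegral.integral_smul, ← intervalIntegral.integral_add]
      · refine intervalIntegral.integral_congr fun r hr => ?_
        rw [uIcc_of_le ht.1.le] at hr
        rw [hZY r (hsub hr), hYe]
        have h1 : Real.exp (b * ω r - c' * r) = e r * Real.exp (-c' * r) := by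
          simp only [hedef]; rw [← Real.exp_add]; congr 1; ring
        have h2 : b ^ p / (p.factorial : ℝ) * c = c' := by rw [hc']; ring
        rw [h1, h2]
        simp only [hF'def, hFdef]
        module
      · exact ((he.smul hF'c).mono hsub).intervalIntegrable_of_Icc ht.1.le
      · exact (hZc.const_smul _).intervalIntegrable _ _
    rw [hint, hY0]
    module
end
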